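/- arXiv:2303.01474 — 2 statements merged into one kernel-verified Lean document; each statement's English description precedes it below -/
import Mathlib

section
/- Let ȳ ∈ S(x̄). Suppose the solution map S is inner semicontinuous at (x̄,ȳ) and the local error bound holds for the system g(x,y) ≤ 0 at (x̄,ȳ). Then the minimal value function v(x) := −V(x) = inf{−f(x,y) : y ∈ F(x)} is continuous at x̄, ∂v(x̄) ⊆ {−∇_x L(x̄,ȳ,λ) : λ ∈ Σ(x̄,ȳ)}, and ∂^∞v(x̄) ⊆ {Σ_i λ_i ∇_x g_i(x̄,ȳ) : λ ∈ Σ⁰(x̄,ȳ)}. If in addition {Σ_i λ_i ∇_x g_i(x̄,ȳ) : λ ∈ Σ⁰(x̄,ȳ)} = {0}, then V is Lipschitz continuous near x̄ and ∂V(x̄) ⊆ ∂^c V(x̄) ⊆ {∇_x L(x̄,ȳ,λ) : λ ∈ Σ(x̄,ȳ)}. -/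
open Filter Topology Metric RealInnerProductSpace

noncomputable section

/-- Feasible region of the parametric maximization problem. -/
def Feas {n m q : ℕ} (g : EuclideanSpace ℝ (Fin n) → EuclideanSpace ℝ (Fin m) → Fin q → ℝ)
    (x : EuclideanSpace ℝ (Fin n)) : Set (EuclideanSpace ℝ (Fin m)) :=
  {y | ∀ i, g x y i ≤ 0}

/-- Maximal value function (EReal valued; `sSup ∅ = ⊥ = -∞`). -/
def Vfun {n m q : ℕ} (f : EuclideanSpace ℝ (Fin n) → EuclideanSpace ℝ (Fin m) → ℝ)
    (g : EuclideanSpace ℝ (Fin n) → EuclideanSpace ℝ (Fin m) → Fin q → ℝ)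
    (x : EuclideanSpace ℝ (Fin n)) : EReal :=
  sSup ((fun y => (f x y : EReal)) '' Feas g x)

/-- Solution map of the parametric maximization problem. -/
def Sol {n m q : ℕ} (f : EuclideanSpace ℝ (Fin n) → EuclideanSpace ℝ (Fin m) → ℝ)
    (g : EuclideanSpace ℝ (Fin n) → EuclideanSpace ℝ (Fin m) → Fin q → ℝ)
    (x : EuclideanSpace ℝ (Fin n)) : Set (EuclideanSpace ℝ (Fin m)) :=
  {y ∈ Feas g x | (f x y : EReal) = Vfun f g x}

/-- Lagrangian `L(x,y,λ) = f(x,y) - λᵀ g(x,y)`. -/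
def Lag {n m q : ℕ} (f : EuclideanSpace ℝ (Fin n) → EuclideanSpace ℝ (Fin m) → ℝ)
    (g : EuclideanSpace ℝ (Fin n) → EuclideanSpace ℝ (Fin m) → Fin q → ℝ)
    (x : EuclideanSpace ℝ (Fin n)) (y : EuclideanSpace ℝ (Fin m)) (lam : Fin q → ℝ) : ℝ :=
  f x y - ∑ i, lam i * g x y i

/-- Partial gradient in `x`. -/
def gradx {n m : ℕ} (φ : EuclideanSpace ℝ (Fin n) → EuclideanSpace ℝ (Fin m) → ℝ)
    (x : EuclideanSpace ℝ (Fin n)) (y : EuclideanSpace ℝ (Fin m)) : EuclideanSpace ℝ (Fin n) :=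
  gradient (fun x' => φ x' y) x

/-- Partial gradient in `y`. -/
def grady {n m : ℕ} (φ : EuclideanSpace ℝ (Fin n) → EuclideanSpace ℝ (Fin m) → ℝ)
    (x : EuclideanSpace ℝ (Fin n)) (y : EuclideanSpace ℝ (Fin m)) : EuclideanSpace ℝ (Fin m) :=
  gradient (fun y' => φ x y') y

/-- `∇_y L(x,y,λ)`. -/
def gradyL {n m q : ℕ} (f : EuclideanSpace ℝ (Fin n) → EuclideanSpace ℝ (Fin m) → ℝ)
    (g : EuclideanSpace ℝ (Fin n) → EuclideanSpace ℝ (Fin m) → Fin q → ℝ)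
    (x : EuclideanSpace ℝ (Fin n)) (y : EuclideanSpace ℝ (Fin m)) (lam : Fin q → ℝ) :
    EuclideanSpace ℝ (Fin m) :=
  grady (fun x y => Lag f g x y lam) x y

/-- `∇_x L(x,y,λ)`. -/
def gradxL {n m q : ℕ} (f : EuclideanSpace ℝ (Fin n) → EuclideanSpace ℝ (Fin m) → ℝ)
    (g : EuclideanSpace ℝ (Fin n) → EuclideanSpace ℝ (Fin m) → Fin q → ℝ)
    (x : EuclideanSpace ℝ (Fin n)) (y : EuclideanSpace ℝ (Fin m)) (lam : Fin q → ℝ) :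
    EuclideanSpace ℝ (Fin n) :=
  gradx (fun x y => Lag f g x y lam) x y

/-- `∇_y g(x,y)ᵀ u ∈ ℝ^q`. -/
def gyTu {n m q : ℕ} (g : EuclideanSpace ℝ (Fin n) → EuclideanSpace ℝ (Fin m) → Fin q → ℝ)
    (x : EuclideanSpace ℝ (Fin n)) (y : EuclideanSpace ℝ (Fin m)) (u : EuclideanSpace ℝ (Fin m)) :
    Fin q → ℝ :=
  fun i => ⟪grady (fun x y => g x y i) x y, u⟫

/-- `∇²_{yy} L(x,y,λ) u`. -/
def hessyyLu {n m q : ℕ} (f : EuclideanSpace ℝ (Fin n) → EuclideanSpace ℝ (Fin m) → ℝ)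
    (g : EuclideanSpace ℝ (Fin n) → EuclideanSpace ℝ (Fin m) → Fin q → ℝ)
    (x : EuclideanSpace ℝ (Fin n)) (y : EuclideanSpace ℝ (Fin m)) (lam : Fin q → ℝ)
    (u : EuclideanSpace ℝ (Fin m)) : EuclideanSpace ℝ (Fin m) :=
  gradient (fun y' => ⟪gradyL f g x y' lam, u⟫) y

/-- `∇²_{xy} L(x,y,λ) u ∈ ℝⁿ` (for `u ∈ ℝᵐ`). -/
def hessxyLu {n m q : ℕ} (f : EuclideanSpace ℝ (Fin n) → EuclideanSpace ℝ (Fin m) → ℝ)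
    (g : EuclideanSpace ℝ (Fin n) → EuclideanSpace ℝ (Fin m) → Fin q → ℝ)
    (x : EuclideanSpace ℝ (Fin n)) (y : EuclideanSpace ℝ (Fin m)) (lam : Fin q → ℝ)
    (u : EuclideanSpace ℝ (Fin m)) : EuclideanSpace ℝ (Fin n) :=
  gradient (fun x' => ⟪gradyL f g x' y lam, u⟫) x

/-- Multiplier set `Σ(x,y)`. -/
def SigmaSet {n m q : ℕ} (f : EuclideanSpace ℝ (Fin n) → EuclideanSpace ℝ (Fin m) → ℝ)
    (g : EuclideanSpace ℝ (Fin n) → EuclideanSpace ℝ (Fin m) → Fin q → ℝ)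
    (x : EuclideanSpace ℝ (Fin n)) (y : EuclideanSpace ℝ (Fin m)) : Set (Fin q → ℝ) :=
  {lam | gradyL f g x y lam = 0 ∧ (∀ i, 0 ≤ lam i) ∧ (∀ i, g x y i ≤ 0) ∧
    ∑ i, lam i * g x y i = 0}

/-- Singular multiplier set `Σ⁰(x,y)`. -/
def SigmaZero {n m q : ℕ} (g : EuclideanSpace ℝ (Fin n) → EuclideanSpace ℝ (Fin m) → Fin q → ℝ)
    (x : EuclideanSpace ℝ (Fin n)) (y : EuclideanSpace ℝ (Fin m)) : Set (Fin q → ℝ) :=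
  {lam | ∑ i, lam i • grady (fun x y => g x y i) x y = 0 ∧ (∀ i, 0 ≤ lam i) ∧
    (∀ i, g x y i ≤ 0) ∧ ∑ i, lam i * g x y i = 0}

/-- The set `Ξ^r(x,y,λ)`. -/
def XiSet {n m q : ℕ} (r : ℝ) (f : EuclideanSpace ℝ (Fin n) → EuclideanSpace ℝ (Fin m) → ℝ)
    (g : EuclideanSpace ℝ (Fin n) → EuclideanSpace ℝ (Fin m) → Fin q → ℝ)
    (x : EuclideanSpace ℝ (Fin n)) (y : EuclideanSpace ℝ (Fin m)) (lam : Fin q → ℝ) :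
    Set (EuclideanSpace ℝ (Fin m)) :=
  {u | hessyyLu f g x y lam u = 0 ∧ (∀ i, 0 ≤ -(gyTu g x y u i) - r * g x y i) ∧
    (∀ i, 0 ≤ lam i) ∧ ∑ i, lam i * (-(gyTu g x y u i) - r * g x y i) = 0}

/-- Fréchet (regular) subdifferential of an `EReal` valued function. -/
def FSub {n : ℕ} (φ : EuclideanSpace ℝ (Fin n) → EReal) (x₀ : EuclideanSpace ℝ (Fin n)) :
    Set (EuclideanSpace ℝ (Fin n)) :=
  {v | ∃ c : ℝ, φ x₀ = (c : EReal) ∧ ∀ ε : ℝ, 0 < ε → ∃ δ : ℝ, 0 < δ ∧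
    ∀ x, ‖x - x₀‖ < δ → ((c + ⟪v, x - x₀⟫ - ε * ‖x - x₀‖ : ℝ) : EReal) ≤ φ x}

/-- Limiting (Mordukhovich) subdifferential. -/
def LSub {n : ℕ} (φ : EuclideanSpace ℝ (Fin n) → EReal) (x₀ : EuclideanSpace ℝ (Fin n)) :
    Set (EuclideanSpace ℝ (Fin n)) :=
  {v | ∃ (xk : ℕ → EuclideanSpace ℝ (Fin n)) (vk : ℕ → EuclideanSpace ℝ (Fin n)),
    (∀ k, vk k ∈ FSub φ (xk k)) ∧ Tendsto xk atTop (𝓝 x₀) ∧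
    Tendsto (fun k => φ (xk k)) atTop (𝓝 (φ x₀)) ∧ Tendsto vk atTop (𝓝 v)}

/-- Horizon (singular) subdifferential. -/
def HorSub {n : ℕ} (φ : EuclideanSpace ℝ (Fin n) → EReal) (x₀ : EuclideanSpace ℝ (Fin n)) :
    Set (EuclideanSpace ℝ (Fin n)) :=
  {v | ∃ (xk : ℕ → EuclideanSpace ℝ (Fin n)) (vk : ℕ → EuclideanSpace ℝ (Fin n)) (tk : ℕ → ℝ),
    (∀ k, vk k ∈ FSub φ (xk k)) ∧ (∀ k, 0 < tk k) ∧ Tendsto tk atTop (𝓝 0) ∧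
    Tendsto xk atTop (𝓝 x₀) ∧ Tendsto (fun k => φ (xk k)) atTop (𝓝 (φ x₀)) ∧
    Tendsto (fun k => tk k • vk k) atTop (𝓝 v)}

/-- Clarke subdifferential (for locally Lipschitz functions): convex hull of the limiting one. -/
def CSub {n : ℕ} (φ : EuclideanSpace ℝ (Fin n) → EReal) (x₀ : EuclideanSpace ℝ (Fin n)) :
    Set (EuclideanSpace ℝ (Fin n)) :=
  convexHull ℝ (LSub φ x₀)

/-- `φ` is (finite-valued and) Lipschitz continuous near `x₀`. -/
def LipschitzNearAt {n : ℕ} (φ : EuclideanSpace ℝ (Fin n) → EReal)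
    (x₀ : EuclideanSpace ℝ (Fin n)) : Prop :=
  ∃ δ : ℝ, 0 < δ ∧ ∃ K : NNReal, ∃ ψ : EuclideanSpace ℝ (Fin n) → ℝ,
    LipschitzWith K ψ ∧ ∀ x ∈ ball x₀ δ, φ x = (ψ x : EReal)

/-- Regular (Fréchet) normal cone. -/
def regNC {n : ℕ} (C : Set (EuclideanSpace ℝ (Fin n))) (x₀ : EuclideanSpace ℝ (Fin n)) :
    Set (EuclideanSpace ℝ (Fin n)) :=
  {ξ | ∀ ε : ℝ, 0 < ε → ∃ δ : ℝ, 0 < δ ∧ ∀ x ∈ C, ‖x - x₀‖ < δ →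
    ⟪ξ, x - x₀⟫ ≤ ε * ‖x - x₀‖}

/-- Limiting (Mordukhovich) normal cone. -/
def limNC {n : ℕ} (C : Set (EuclideanSpace ℝ (Fin n))) (x₀ : EuclideanSpace ℝ (Fin n)) :
    Set (EuclideanSpace ℝ (Fin n)) :=
  {ξ | ∃ (xk : ℕ → EuclideanSpace ℝ (Fin n)) (ξk : ℕ → EuclideanSpace ℝ (Fin n)),
    (∀ k, xk k ∈ C) ∧ (∀ k, ξk k ∈ regNC C (xk k)) ∧
    Tendsto xk atTop (𝓝 x₀) ∧ Tendsto ξk atTop (𝓝 ξ)}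

/-- Inner semicontinuity of the solution map at `(x̄, ȳ)`. -/
def InnerSemicont {n m q : ℕ} (f : EuclideanSpace ℝ (Fin n) → EuclideanSpace ℝ (Fin m) → ℝ)
    (g : EuclideanSpace ℝ (Fin n) → EuclideanSpace ℝ (Fin m) → Fin q → ℝ)
    (xb : EuclideanSpace ℝ (Fin n)) (yb : EuclideanSpace ℝ (Fin m)) : Prop :=
  ∀ xk : ℕ → EuclideanSpace ℝ (Fin n), Tendsto xk atTop (𝓝 xb) →
    ∃ yk : ℕ → EuclideanSpace ℝ (Fin m), (∀ k, yk k ∈ Sol f g (xk k)) ∧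
      Tendsto yk atTop (𝓝 yb)

/-- Local error bound for the system `g(x,y) ≤ 0` at `(x̄, ȳ)`. -/
def LocalErrorBound {n m q : ℕ}
    (g : EuclideanSpace ℝ (Fin n) → EuclideanSpace ℝ (Fin m) → Fin q → ℝ)
    (xb : EuclideanSpace ℝ (Fin n)) (yb : EuclideanSpace ℝ (Fin m)) : Prop :=
  ∃ κ δ : ℝ, 0 < κ ∧ 0 < δ ∧
    ∀ x y, ‖((x, y) : EuclideanSpace ℝ (Fin n) × EuclideanSpace ℝ (Fin m)) - (xb, yb)‖ < δ →
      Metric.infDist ((x, y) : EuclideanSpace ℝ (Fin n) × EuclideanSpace ℝ (Fin m))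
          {p : EuclideanSpace ℝ (Fin n) × EuclideanSpace ℝ (Fin m) | ∀ i, g p.1 p.2 i ≤ 0}
        ≤ κ * ∑ i, max (g x y i) 0

/-- MFCQ for the system `g(x̄, ·) ≤ 0` at `ȳ`. -/
def MFCQy {n m q : ℕ} (g : EuclideanSpace ℝ (Fin n) → EuclideanSpace ℝ (Fin m) → Fin q → ℝ)
    (xb : EuclideanSpace ℝ (Fin n)) (yb : EuclideanSpace ℝ (Fin m)) : Prop :=
  ∀ lam : Fin q → ℝ, (∀ i, 0 ≤ lam i) → (∑ i, lam i * g xb yb i = 0) →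
    (∀ i, g xb yb i ≤ 0) → (∑ i, lam i • grady (fun x y => g x y i) xb yb = 0) → lam = 0

/-- Restricted sup-compactness at `x̄`. -/
def RestrictedSupCompact {n m q : ℕ}
    (f : EuclideanSpace ℝ (Fin n) → EuclideanSpace ℝ (Fin m) → ℝ)
    (g : EuclideanSpace ℝ (Fin n) → EuclideanSpace ℝ (Fin m) → Fin q → ℝ)
    (xb : EuclideanSpace ℝ (Fin n)) : Prop :=
  (∃ c : ℝ, Vfun f g xb = (c : EReal)) ∧
  ∃ ε δ : ℝ, 0 < ε ∧ 0 < δ ∧ ∃ Ω : Set (EuclideanSpace ℝ (Fin m)), IsCompact Ω ∧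
    ∀ x, ‖x - xb‖ < δ → Vfun f g xb - (ε : EReal) < Vfun f g x → (Sol f g x ∩ Ω).Nonempty

/-- Robinson stability of the feasible map at `(x̄, ȳ)`. -/
def RobinsonStability {n m q : ℕ}
    (g : EuclideanSpace ℝ (Fin n) → EuclideanSpace ℝ (Fin m) → Fin q → ℝ)
    (xb : EuclideanSpace ℝ (Fin n)) (yb : EuclideanSpace ℝ (Fin m)) : Prop :=
  ∃ κ δ : ℝ, 0 < κ ∧ 0 < δ ∧
    ∀ x y, ‖((x, y) : EuclideanSpace ℝ (Fin n) × EuclideanSpace ℝ (Fin m)) - (xb, yb)‖ < δ →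
      Metric.infDist y (Feas g x) ≤ κ * ∑ i, max (g x y i) 0

/-- A constraint qualification holds at the feasible point `w₀` of the system
`{w : G w ≤ 0, H w = 0}`: local minimizers of C¹ functions over the feasible set
satisfy the KKT conditions. -/
def CQAt {W : Type} [NormedAddCommGroup W] [NormedSpace ℝ W] {p p' : ℕ}
    (G : W → Fin p → ℝ) (H : W → Fin p' → ℝ) (w₀ : W) : Prop :=
  ∀ θ : W → ℝ, ContDiff ℝ 1 θ →
    IsLocalMinOn θ {w | (∀ i, G w i ≤ 0) ∧ ∀ j, H w j = 0} w₀ →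
    ∃ (lam : Fin p → ℝ) (mu : Fin p' → ℝ), (∀ i, 0 ≤ lam i) ∧
      (fderiv ℝ θ w₀ + ∑ i, lam i • fderiv ℝ (fun w => G w i) w₀ +
        ∑ j, mu j • fderiv ℝ (fun w => H w j) w₀ = 0) ∧
      ∑ i, lam i * G w₀ i = 0

/-- Inequality constraints of the Wolfe dual system (`λ ≥ 0`). -/
def WolfeG (n m q : ℕ) :
    (EuclideanSpace ℝ (Fin n) × EuclideanSpace ℝ (Fin m) × (Fin q → ℝ)) → Fin q → ℝ :=
  fun w i => -(w.2.2 i)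

/-- Equality constraints of the Wolfe dual system (`∇_y L(x,y,λ) = 0`). -/
def WolfeH {n m q : ℕ} (f : EuclideanSpace ℝ (Fin n) → EuclideanSpace ℝ (Fin m) → ℝ)
    (g : EuclideanSpace ℝ (Fin n) → EuclideanSpace ℝ (Fin m) → Fin q → ℝ) :
    (EuclideanSpace ℝ (Fin n) × EuclideanSpace ℝ (Fin m) × (Fin q → ℝ)) → Fin m → ℝ :=
  fun w j => gradyL f g w.1 w.2.1 w.2.2 j

/-- The multiplier set `M(β, x, y)` of the parametric program. -/
def MultSetP {n m q : ℕ} (g : EuclideanSpace ℝ (Fin n) → EuclideanSpace ℝ (Fin m) → Fin q → ℝ)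
    (β : EuclideanSpace ℝ (Fin m)) (x : EuclideanSpace ℝ (Fin n))
    (y : EuclideanSpace ℝ (Fin m)) : Set (Fin q → ℝ) :=
  {lam | β - ∑ i, lam i • grady (fun x y => g x y i) x y = 0 ∧ (∀ i, 0 ≤ lam i) ∧
    ∑ i, lam i * g x y i = 0 ∧ ∀ i, g x y i ≤ 0}

/-- A stable parametric CQ holds at `ȳ ∈ F(x̄)` for the parametric system `g(x,·) ≤ 0`. -/
def StableParamCQ {n m q : ℕ} (f : EuclideanSpace ℝ (Fin n) → EuclideanSpace ℝ (Fin m) → ℝ)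
    (g : EuclideanSpace ℝ (Fin n) → EuclideanSpace ℝ (Fin m) → Fin q → ℝ)
    (xb : EuclideanSpace ℝ (Fin n)) (yb : EuclideanSpace ℝ (Fin m)) : Prop :=
  ∃ P : EuclideanSpace ℝ (Fin n) → EuclideanSpace ℝ (Fin m) → Prop,
    (∃ δ : ℝ, 0 < δ ∧ ∀ x y, y ∈ Feas g x → ‖x - xb‖ < δ → ‖y - yb‖ < δ → P x y) ∧
    (∀ x y, P x y → y ∈ Feas g x → IsLocalMaxOn (f x) (Feas g x) y →
      (MultSetP g (grady f x y) x y).Nonempty) ∧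
    (∀ (βk : ℕ → EuclideanSpace ℝ (Fin m)) (xk : ℕ → EuclideanSpace ℝ (Fin n))
        (yk : ℕ → EuclideanSpace ℝ (Fin m)) (βb : EuclideanSpace ℝ (Fin m)),
      Tendsto βk atTop (𝓝 βb) → Tendsto xk atTop (𝓝 xb) → Tendsto yk atTop (𝓝 yb) →
      (∀ k, (MultSetP g (βk k) (xk k) (yk k)).Nonempty) →
      ∃ (lamk : ℕ → Fin q → ℝ) (φ : ℕ → ℕ) (lamb : Fin q → ℝ),
        StrictMono φ ∧ (∀ k, lamk k ∈ MultSetP g (βk k) (xk k) (yk k)) ∧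
        Tendsto (lamk ∘ φ) atTop (𝓝 lamb) ∧ lamb ∈ MultSetP g βb xb yb)

/-- The multiplier set `M(β, w)` of a (nonparametric) system `{w : G w ≤ 0, H w = 0}`. -/
def MultSetW {W : Type} [NormedAddCommGroup W] [NormedSpace ℝ W] {p p' : ℕ}
    (G : W → Fin p → ℝ) (H : W → Fin p' → ℝ) (β : W →L[ℝ] ℝ) (w : W) :
    Set ((Fin p → ℝ) × (Fin p' → ℝ)) :=
  {lm | (∀ i, 0 ≤ lm.1 i) ∧
    (β - ∑ i, lm.1 i • fderiv ℝ (fun w => G w i) w -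
      ∑ j, lm.2 j • fderiv ℝ (fun w => H w j) w = 0) ∧
    ∑ i, lm.1 i * G w i = 0}

/-- A stable CQ holds at the feasible point `w̄` of the system `{w : G w ≤ 0, H w = 0}`. -/
def StableCQ {W : Type} [NormedAddCommGroup W] [NormedSpace ℝ W] {p p' : ℕ}
    (G : W → Fin p → ℝ) (H : W → Fin p' → ℝ) (wb : W) : Prop :=
  ∃ P : W → Prop,
    (P wb ∧ ∃ δ : ℝ, 0 < δ ∧ ∀ w, (∀ i, G w i ≤ 0) → (∀ j, H w j = 0) → ‖w - wb‖ < δ → P w) ∧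
    (∀ w, P w → (∀ i, G w i ≤ 0) → (∀ j, H w j = 0) →
      ∀ θ : W → ℝ, ContDiff ℝ 1 θ →
        IsLocalMinOn θ {w' | (∀ i, G w' i ≤ 0) ∧ ∀ j, H w' j = 0} w →
        ∃ (lam : Fin p → ℝ) (mu : Fin p' → ℝ), (∀ i, 0 ≤ lam i) ∧
          (fderiv ℝ θ w + ∑ i, lam i • fderiv ℝ (fun w => G w i) w +
            ∑ j, mu j • fderiv ℝ (fun w => H w j) w = 0) ∧
          ∑ i, lam i * G w i = 0) ∧
    (∀ (βk : ℕ → W →L[ℝ] ℝ) (wk : ℕ → W) (βb : W →L[ℝ] ℝ),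
      Tendsto βk atTop (𝓝 βb) → Tendsto wk atTop (𝓝 wb) →
      (∀ k, (∀ i, G (wk k) i ≤ 0) ∧ ∀ j, H (wk k) j = 0) →
      (∀ k, (MultSetW G H (βk k) (wk k)).Nonempty) →
      ∃ (lmk : ℕ → (Fin p → ℝ) × (Fin p' → ℝ)) (φ : ℕ → ℕ) (lmb : (Fin p → ℝ) × (Fin p' → ℝ)),
        StrictMono φ ∧ (∀ k, lmk k ∈ MultSetW G H (βk k) (wk k)) ∧
        Tendsto (lmk ∘ φ) atTop (𝓝 lmb) ∧ lmb ∈ MultSetW G H βb wb)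

/-- Critical cone of `(P_x̄)` at `y` associated with the multiplier `λ`. -/
def CritCone {n m q : ℕ} (g : EuclideanSpace ℝ (Fin n) → EuclideanSpace ℝ (Fin m) → Fin q → ℝ)
    (xb : EuclideanSpace ℝ (Fin n)) (y : EuclideanSpace ℝ (Fin m)) (lam : Fin q → ℝ) :
    Set (EuclideanSpace ℝ (Fin m)) :=
  {d | ∀ i, g xb y i = 0 →
    (0 < lam i → ⟪grady (fun x y => g x y i) xb y, d⟫ = 0) ∧
    (lam i = 0 → ⟪grady (fun x y => g x y i) xb y, d⟫ ≤ 0)}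

/-- Second order sufficient condition at `(y, λ)` for `(P_x̄)`. -/
def SOSC {n m q : ℕ} (f : EuclideanSpace ℝ (Fin n) → EuclideanSpace ℝ (Fin m) → ℝ)
    (g : EuclideanSpace ℝ (Fin n) → EuclideanSpace ℝ (Fin m) → Fin q → ℝ)
    (xb : EuclideanSpace ℝ (Fin n)) (y : EuclideanSpace ℝ (Fin m)) (lam : Fin q → ℝ) : Prop :=
  ∀ d ∈ CritCone g xb y lam, d ≠ 0 → ⟪d, hessyyLu f g xb y lam d⟫ < 0

/-- `(x̄, ȳ)` is a local solution of the minimax problem in the sense of Stackelberg. -/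
def StackelbergLocal {n m q : ℕ} (f : EuclideanSpace ℝ (Fin n) → EuclideanSpace ℝ (Fin m) → ℝ)
    (g : EuclideanSpace ℝ (Fin n) → EuclideanSpace ℝ (Fin m) → Fin q → ℝ)
    (X : Set (EuclideanSpace ℝ (Fin n))) (xb : EuclideanSpace ℝ (Fin n))
    (yb : EuclideanSpace ℝ (Fin m)) : Prop :=
  xb ∈ X ∧ yb ∈ Sol f g xb ∧ IsLocalMinOn (Vfun f g) X xb

/-- Feasible region of the MPEC reformulation `(P_MPEC)`. -/
def MPECFeas {n m q : ℕ} (f : EuclideanSpace ℝ (Fin n) → EuclideanSpace ℝ (Fin m) → ℝ)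
    (g : EuclideanSpace ℝ (Fin n) → EuclideanSpace ℝ (Fin m) → Fin q → ℝ)
    (X : Set (EuclideanSpace ℝ (Fin n))) :
    Set (EuclideanSpace ℝ (Fin n) × EuclideanSpace ℝ (Fin m) × (Fin q → ℝ)) :=
  {w | w.1 ∈ X ∧ gradyL f g w.1 w.2.1 w.2.2 = 0 ∧ (∀ i, g w.1 w.2.1 i ≤ 0) ∧
    (∀ i, 0 ≤ w.2.2 i) ∧ ∑ i, w.2.2 i * g w.1 w.2.1 i = 0}

/-- S-stationarity for `(P_MPEC)`. -/
def SStationary {n m q : ℕ} (f : EuclideanSpace ℝ (Fin n) → EuclideanSpace ℝ (Fin m) → ℝ)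
    (g : EuclideanSpace ℝ (Fin n) → EuclideanSpace ℝ (Fin m) → Fin q → ℝ)
    (X : Set (EuclideanSpace ℝ (Fin n))) (xb : EuclideanSpace ℝ (Fin n))
    (yb : EuclideanSpace ℝ (Fin m)) (lamb : Fin q → ℝ) : Prop :=
  ∃ (u : EuclideanSpace ℝ (Fin m)) (α β : Fin q → ℝ),
    -(gradx f xb yb + ∑ i, α i • gradx (fun x y => g x y i) xb yb +
        hessxyLu f g xb yb lamb u) ∈ limNC X xb ∧
    grady f xb yb + ∑ i, α i • grady (fun x y => g x y i) xb yb +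
      hessyyLu f g xb yb lamb u = 0 ∧
    (∀ i, -(gyTu g xb yb u i) - β i = 0) ∧
    (∀ i, g xb yb i < 0 → lamb i = 0 → α i = 0) ∧
    (∀ i, g xb yb i = 0 → 0 < lamb i → β i = 0) ∧
    (∀ i, g xb yb i = 0 → lamb i = 0 → 0 ≤ α i ∧ 0 ≤ β i)


/-- Optimal value function of the Wolfe dual (`sInf ∅ = ⊤`). -/
def VD {n m q : ℕ} (f : EuclideanSpace ℝ (Fin n) → EuclideanSpace ℝ (Fin m) → ℝ)
    (g : EuclideanSpace ℝ (Fin n) → EuclideanSpace ℝ (Fin m) → Fin q → ℝ)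
    (x : EuclideanSpace ℝ (Fin n)) : EReal :=
  sInf ((fun p : EuclideanSpace ℝ (Fin m) × (Fin q → ℝ) => (Lag f g x p.1 p.2 : EReal)) ''
    {p | gradyL f g x p.1 p.2 = 0 ∧ ∀ i, 0 ≤ p.2 i})

/-- Strict differentiability of an `EReal`-valued function at `x₀` with gradient `ζ`. -/
def StrictDiffAt {n : ℕ} (φ : EuclideanSpace ℝ (Fin n) → EReal)
    (x₀ ζ : EuclideanSpace ℝ (Fin n)) : Prop :=
  ∀ ε : ℝ, 0 < ε → ∃ δ : ℝ, 0 < δ ∧ ∀ x x', ‖x - x₀‖ < δ → ‖x' - x₀‖ < δ →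
    ∃ a b : ℝ, φ x = (a : EReal) ∧ φ x' = (b : EReal) ∧
      |a - b - ⟪ζ, x - x'⟫| ≤ ε * ‖x - x'‖

/-- `f` and `g` are separable with respect to `x` and `y`. -/
def SeparableFG {n m q : ℕ} (f : EuclideanSpace ℝ (Fin n) → EuclideanSpace ℝ (Fin m) → ℝ)
    (g : EuclideanSpace ℝ (Fin n) → EuclideanSpace ℝ (Fin m) → Fin q → ℝ) : Prop :=
  ∃ (f₁ : EuclideanSpace ℝ (Fin n) → ℝ) (f₂ : EuclideanSpace ℝ (Fin m) → ℝ)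
    (g₁ : EuclideanSpace ℝ (Fin n) → Fin q → ℝ) (g₂ : EuclideanSpace ℝ (Fin m) → Fin q → ℝ),
    (∀ x y, f x y = f₁ x + f₂ y) ∧ ∀ x y i, g x y i = g₁ x i + g₂ y i

end

/-- An approximate normal functional `w` to `{G ≤ 0}` at `p` is dominated by the linearized active
constraints whenever an error bound holds around `p`. -/
theorem apply_le_sum_max_of_errorBound {P : Type*} [NormedAddCommGroup P] [NormedSpace ℝ P] {q : ℕ}
    {G : P → Fin q → ℝ} {a : Fin q → P →L[ℝ] ℝ} {w : P →L[ℝ] ℝ} {p : P} {κ : ℝ} (hκ : 0 ≤ κ)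
    (hp : ∀ i, G p i ≤ 0) (ha : ∀ i, HasFDerivAt (fun z => G z i) (a i) p)
    (hw : ∀ ε > 0, ∀ᶠ z in 𝓝 p, (∀ i, G z i ≤ 0) → w (z - p) ≤ ε * ‖z - p‖)
    (heb : ∀ᶠ z in 𝓝 p, infDist z {z | ∀ i, G z i ≤ 0} ≤ κ * ∑ i, max (G z i) 0) (d : P) :
    w d ≤ κ * ‖w‖ * ∑ i, if G p i = 0 then max (a i d) 0 else 0 := by
  set S : ℝ := ∑ i, if G p i = 0 then max (a i d) 0 else 0 with hS
  have key : ∀ ε > 0,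
      w d ≤ κ * ‖w‖ * (S + q * ε) + ε * (2 * ‖d‖ + ε) + ‖w‖ * ε := by
    intro ε hε
    have hline : Tendsto (fun t : ℝ => p + t • d) (𝓝[>] 0) (𝓝 p) := by
      have : Tendsto (fun t : ℝ => p + t • d) (𝓝 0) (𝓝 (p + (0 : ℝ) • d)) :=
        (by fun_prop : Continuous fun t : ℝ => p + t • d).tendsto 0
      rw [zero_smul, add_zero] at this
      exact this.mono_left nhdsWithin_le_nhds
    have hG : ∀ i, ∀ᶠ t : ℝ in 𝓝[>] 0,
        max (G (p + t • d) i) 0 ≤ t * ((if G p i = 0 then max (a i d) 0 else 0) + ε) := by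
      intro i
      by_cases hi : G p i = 0
      · have h1 := (hasDerivAt_iff_isLittleO_nhds_zero.1 ((ha i).hasLineDerivAt d)).def hε
        filter_upwards [h1.filter_mono nhdsWithin_le_nhds, self_mem_nhdsWithin] with t ht ht0
        simp only [zero_add, zero_smul, add_zero, hi, sub_zero, smul_eq_mul, Real.norm_eq_abs,
          if_true] at ht ⊢
        have ht0 : 0 < t := ht0
        rw [abs_of_pos ht0] at ht
        have h2 := (abs_le.1 ht).2
        have h3 : t * a i d ≤ t * max (a i d) 0 := by gcongr; exact le_max_left _ _
        have h4 : 0 ≤ t * max (a i d) 0 := by positivity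
        refine max_le ?_ ?_
        · linarith
        · nlinarith
      · have hlt : G p i < 0 := lt_of_le_of_ne (hp i) hi
        filter_upwards [hline.eventually ((ha i).continuousAt.eventually_lt_const hlt),
          self_mem_nhdsWithin] with t ht ht0
        have ht0 : 0 < t := ht0
        rw [max_eq_right ht.le]
        simp only [hi, if_false, zero_add]
        positivity
    obtain ⟨δ, hδ, hwδ⟩ := Metric.eventually_nhds_iff.1 (hw ε hε)
    have hsmall : ∀ᶠ t : ℝ in 𝓝[>] 0, t * (2 * ‖d‖ + ε) < δ := by
      have : Tendsto (fun t : ℝ => t * (2 * ‖d‖ + ε)) (𝓝 0) (𝓝 (0 * (2 * ‖d‖ + ε))) :=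
        (by fun_prop : Continuous fun t : ℝ => t * (2 * ‖d‖ + ε)).tendsto 0
      rw [zero_mul] at this
      exact (this.mono_left nhdsWithin_le_nhds).eventually_lt_const hδ
    obtain ⟨t, h1, h2, h3, ht⟩ := ((hline.eventually heb).and ((eventually_all.2 hG).and
      (hsmall.and self_mem_nhdsWithin))).exists
    have ht : 0 < t := ht
    obtain ⟨z, hzC, hz⟩ := (infDist_lt_iff ⟨p, show p ∈ {z | ∀ i, G z i ≤ 0} from hp⟩).1
      (lt_add_of_pos_right (infDist (p + t • d) {z | ∀ i, G z i ≤ 0}) (mul_pos ht hε))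
    have hzp : ‖z - p‖ ≤ t * (2 * ‖d‖ + ε) := by
      have h4 : infDist (p + t • d) {z | ∀ i, G z i ≤ 0} ≤ t * ‖d‖ := by
        refine (infDist_le_dist_of_mem (show p ∈ {z | ∀ i, G z i ≤ 0} from hp)).trans ?_
        rw [dist_eq_norm, add_sub_cancel_left, norm_smul, Real.norm_of_nonneg ht.le]
      have h5 : ‖z - p‖ ≤ ‖z - (p + t • d)‖ + ‖t • d‖ := by
        have : z - p = (z - (p + t • d)) + t • d := by abel
        rw [this]
        exact norm_add_le _ _
      rw [norm_smul, Real.norm_of_nonneg ht.le] at h5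
      rw [dist_comm, dist_eq_norm] at hz
      linarith
    have hwz := hwδ (y := z) (by rw [dist_eq_norm]; linarith) hzC
    have hwt : w (p + t • d - z) ≤ ‖w‖ * (κ * ∑ i, max (G (p + t • d) i) 0 + t * ε) := by
      refine (le_abs_self _).trans ((w.le_opNorm _).trans ?_)
      rw [dist_eq_norm] at hz
      gcongr
      linarith
    have hsum : ∑ i, max (G (p + t • d) i) 0 ≤ t * (S + q * ε) := by
      refine (Finset.sum_le_sum fun i _ => h2 i).trans (le_of_eq ?_)
      rw [← Finset.mul_sum, Finset.sum_add_distrib]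
      simp [hS]
    have hdec : t * w d = w (z - p) + w (p + t • d - z) := by
      rw [← map_add, ← smul_eq_mul, ← map_smul]
      congr 1
      abel
    have h6 : ‖w‖ * (κ * ∑ i, max (G (p + t • d) i) 0 + t * ε) ≤
        ‖w‖ * (κ * (t * (S + q * ε)) + t * ε) := by gcongr
    have h7 : ε * ‖z - p‖ ≤ ε * (t * (2 * ‖d‖ + ε)) := by gcongr
    refine le_of_mul_le_mul_left ?_ ht
    calc t * w d ≤ ε * (t * (2 * ‖d‖ + ε)) + ‖w‖ * (κ * (t * (S + q * ε)) + t * ε) := by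
          linarith
      _ = _ := by ring
  have hlim : Tendsto (fun ε : ℝ => κ * ‖w‖ * (S + q * ε) + ε * (2 * ‖d‖ + ε) + ‖w‖ * ε)
      (𝓝[>] 0) (𝓝 (κ * ‖w‖ * S)) := by
    have : Tendsto (fun ε : ℝ => κ * ‖w‖ * (S + q * ε) + ε * (2 * ‖d‖ + ε) + ‖w‖ * ε)
        (𝓝 0) (𝓝 (κ * ‖w‖ * (S + q * 0) + 0 * (2 * ‖d‖ + 0) + ‖w‖ * 0)) :=
      (by fun_prop : Continuous fun ε : ℝ =>
        κ * ‖w‖ * (S + q * ε) + ε * (2 * ‖d‖ + ε) + ‖w‖ * ε).tendsto 0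
    simp only [mul_zero, add_zero, zero_mul] at this
    exact this.mono_left nhdsWithin_le_nhds
  exact ge_of_tendsto hlim (by filter_upwards [self_mem_nhdsWithin] with ε hε using key ε hε)

/-- A bounded version of Farkas' lemma on a product of Euclidean spaces. -/
theorem exists_multiplier_of_le_sum_max {E F : Type*} [NormedAddCommGroup E]
    [InnerProductSpace ℝ E] [CompleteSpace E] [NormedAddCommGroup F] [InnerProductSpace ℝ F]
    [CompleteSpace F] {q : ℕ} (A : Fin q → E) (B : Fin q → F) (α : E) (β : F) (I : Fin q → Prop)
    [DecidablePred I] {M : ℝ} (hM : 0 ≤ M)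
    (h : ∀ d e, ⟪α, d⟫ + ⟪β, e⟫ ≤
      M * ∑ i, if I i then max (⟪A i, d⟫ + ⟪B i, e⟫) 0 else 0) :
    ∃ lam : Fin q → ℝ, (∀ i, 0 ≤ lam i) ∧ (∀ i, lam i ≤ M) ∧ (∀ i, ¬ I i → lam i = 0) ∧
      α = ∑ i, lam i • A i ∧ β = ∑ i, lam i • B i := by
  set T : (Fin q → ℝ) →L[ℝ] E × F :=
    ∑ i, (ContinuousLinearMap.proj (R := ℝ) (φ := fun _ : Fin q => ℝ) i).smulRight (A i, B i)
    with hT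
  have hTapp : ∀ lam, T lam = ∑ i, lam i • (A i, B i) := by
    intro lam
    simp [hT]
  set box : Set (Fin q → ℝ) := Set.Icc 0 (fun i => if I i then M else 0) with hbox
  by_cases hmem : (α, β) ∈ T '' box
  · obtain ⟨lam, ⟨h0, h1⟩, hlam⟩ := hmem
    rw [hTapp] at hlam
    refine ⟨lam, h0, fun i => (h1 i).trans ?_, fun i hi => le_antisymm ?_ (h0 i), ?_, ?_⟩
    · dsimp only
      split_ifs <;> simp [hM]
    · simpa [hi] using h1 i
    · simpa [Prod.fst_sum] using (congrArg Prod.fst hlam).symm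
    · simpa [Prod.snd_sum] using (congrArg Prod.snd hlam).symm
  · exfalso
    obtain ⟨Φ, u, hu, hlt⟩ := geometric_hahn_banach_closed_point
      ((convex_Icc _ _).linear_image T.toLinearMap)
      ((isCompact_Icc.image T.continuous).isClosed) hmem
    set d := (InnerProductSpace.toDual ℝ E).symm (Φ.comp (ContinuousLinearMap.inl ℝ E F)) with hd
    set e := (InnerProductSpace.toDual ℝ F).symm (Φ.comp (ContinuousLinearMap.inr ℝ E F)) with he
    have hΦ : ∀ x y, Φ (x, y) = ⟪x, d⟫ + ⟪y, e⟫ := by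
      intro x y
      rw [real_inner_comm, real_inner_comm e y, hd, he, InnerProductSpace.toDual_symm_apply,
        InnerProductSpace.toDual_symm_apply]
      simp [← map_add]
    set lam : Fin q → ℝ := fun i => if I i ∧ 0 < ⟪A i, d⟫ + ⟪B i, e⟫ then M else 0 with hlam
    have hlamT : Φ (T lam) < u := by
      refine hu _ ⟨lam, ⟨fun i => ?_, fun i => ?_⟩, rfl⟩
      · simp only [hlam, Pi.zero_apply]; split_ifs <;> simp [hM]
      · simp only [hlam]
        by_cases hi : I i
        · simp only [hi, true_and, if_true]; split_ifs <;> simp [hM]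
        · simp [hi]
    rw [hTapp, map_sum] at hlamT
    have := h d e
    rw [Finset.mul_sum] at this
    rw [hΦ] at hlt
    refine absurd (hlt.trans_le this) (not_lt.2 (le_trans (le_of_eq ?_) hlamT.le))
    refine Finset.sum_congr rfl fun i _ => ?_
    rw [map_smul, hΦ, smul_eq_mul]
    by_cases hi : I i
    · by_cases hpos : 0 < ⟪A i, d⟫ + ⟪B i, e⟫
      · simp [hlam, hi, hpos, max_eq_left hpos.le]
      · simp [hlam, hi, hpos, max_eq_right (not_lt.1 hpos)]
    · simp [hlam, hi]

theorem fderiv_uncurry_apply {n m : ℕ}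
    {φ : EuclideanSpace ℝ (Fin n) → EuclideanSpace ℝ (Fin m) → ℝ}
    {x : EuclideanSpace ℝ (Fin n)} {y : EuclideanSpace ℝ (Fin m)}
    (hφ : DifferentiableAt ℝ
      (fun p : EuclideanSpace ℝ (Fin n) × EuclideanSpace ℝ (Fin m) => φ p.1 p.2) (x, y))
    (d : EuclideanSpace ℝ (Fin n)) (e : EuclideanSpace ℝ (Fin m)) :
    fderiv ℝ (fun p : EuclideanSpace ℝ (Fin n) × EuclideanSpace ℝ (Fin m) => φ p.1 p.2) (x, y)
      (d, e) = ⟪gradx φ x y, d⟫ + ⟪grady φ x y, e⟫ := by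
  have hx := hφ.hasFDerivAt.comp x (hasFDerivAt_prodMk_left (𝕜 := ℝ) x y)
  have hy := hφ.hasFDerivAt.comp y (hasFDerivAt_prodMk_right (𝕜 := ℝ) x y)
  rw [gradx, grady, inner_gradient_left, inner_gradient_left]
  rw [show fderiv ℝ (fun x' => φ x' y) x = _ from hx.fderiv,
    show fderiv ℝ (fun y' => φ x y') y = _ from hy.fderiv]
  simp [← map_add]

theorem gradient_sub_sum {E : Type*} [NormedAddCommGroup E] [InnerProductSpace ℝ E]
    [CompleteSpace E] {q : ℕ} {φ : E → ℝ} {γ : E → Fin q → ℝ} {z : E}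
    (hφ : DifferentiableAt ℝ φ z) (hγ : ∀ i, DifferentiableAt ℝ (fun z => γ z i) z)
    (lam : Fin q → ℝ) :
    gradient (fun z => φ z - ∑ i, lam i * γ z i) z =
      gradient φ z - ∑ i, lam i • gradient (fun z => γ z i) z := by
  have h : HasFDerivAt (fun z => φ z - ∑ i, lam i * γ z i)
      (fderiv ℝ φ z - ∑ i, lam i • fderiv ℝ (fun z => γ z i) z) z :=
    hφ.hasFDerivAt.sub (HasFDerivAt.fun_sum fun i _ => (hγ i).hasFDerivAt.const_mul (lam i))
  simp [gradient, h.fderiv, map_sub, map_sum]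

section Multipliers

variable {n m q : ℕ} {f : EuclideanSpace ℝ (Fin n) → EuclideanSpace ℝ (Fin m) → ℝ}
  {g : EuclideanSpace ℝ (Fin n) → EuclideanSpace ℝ (Fin m) → Fin q → ℝ}
  {x : EuclideanSpace ℝ (Fin n)} {y : EuclideanSpace ℝ (Fin m)}

theorem gradxL_eq
    (hf : ContDiff ℝ 1 (fun p : EuclideanSpace ℝ (Fin n) × EuclideanSpace ℝ (Fin m) => f p.1 p.2))
    (hg : ∀ i, ContDiff ℝ 1
      (fun p : EuclideanSpace ℝ (Fin n) × EuclideanSpace ℝ (Fin m) => g p.1 p.2 i))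
    (lam : Fin q → ℝ) :
    gradxL f g x y lam = gradx f x y - ∑ i, lam i • gradx (fun x y => g x y i) x y :=
  gradient_sub_sum (γ := fun x i => g x y i)
    ((hf.differentiable (by simp)).comp (f := fun x => (x, y)) (by fun_prop) x)
    (fun i => ((hg i).differentiable (by simp)).comp (f := fun x => (x, y)) (by fun_prop) x) lam

theorem gradyL_eq
    (hf : ContDiff ℝ 1 (fun p : EuclideanSpace ℝ (Fin n) × EuclideanSpace ℝ (Fin m) => f p.1 p.2))
    (hg : ∀ i, ContDiff ℝ 1
      (fun p : EuclideanSpace ℝ (Fin n) × EuclideanSpace ℝ (Fin m) => g p.1 p.2 i))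
    (lam : Fin q → ℝ) :
    gradyL f g x y lam = grady f x y - ∑ i, lam i • grady (fun x y => g x y i) x y :=
  gradient_sub_sum (γ := fun y i => g x y i)
    ((hf.differentiable (by simp)).comp (f := fun y => (x, y)) (by fun_prop) y)
    (fun i => ((hg i).differentiable (by simp)).comp (f := fun y => (x, y)) (by fun_prop) y) lam

end Multipliers

theorem mem_FSub_coe_iff {n : ℕ} {φ : EuclideanSpace ℝ (Fin n) → ℝ}
    {x₀ v : EuclideanSpace ℝ (Fin n)} :
    v ∈ FSub (fun x => (φ x : EReal)) x₀ ↔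
      ∀ ε > 0, ∀ᶠ x in 𝓝 x₀, φ x₀ + ⟪v, x - x₀⟫ - ε * ‖x - x₀‖ ≤ φ x := by
  simp only [Metric.eventually_nhds_iff, dist_eq_norm]
  constructor
  · rintro ⟨c, hc, h⟩ ε hε
    obtain ⟨δ, hδ, H⟩ := h ε hε
    refine ⟨δ, hδ, fun x hx => ?_⟩
    rw [EReal.coe_eq_coe_iff.1 hc]
    exact EReal.coe_le_coe_iff.1 (H x hx)
  · intro h
    refine ⟨φ x₀, rfl, fun ε hε => ?_⟩
    obtain ⟨δ, hδ, H⟩ := h ε hε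
    exact ⟨δ, hδ, fun x hx => EReal.coe_le_coe_iff.2 (H hx)⟩

/-- Proximal subgradients are Fréchet subgradients. -/
theorem mem_FSub_of_proximal {n : ℕ} {φ : EuclideanSpace ℝ (Fin n) → ℝ}
    {x₀ v : EuclideanSpace ℝ (Fin n)} {C : ℝ}
    (h : ∀ᶠ x in 𝓝 x₀, φ x₀ + ⟪v, x - x₀⟫ - C * ‖x - x₀‖ ^ 2 ≤ φ x) :
    v ∈ FSub (fun x => (φ x : EReal)) x₀ := by
  refine mem_FSub_coe_iff.2 fun ε hε => ?_
  have hsmall : ∀ᶠ x in 𝓝 x₀, C * ‖x - x₀‖ < ε := by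
    have : Tendsto (fun x => C * ‖x - x₀‖) (𝓝 x₀) (𝓝 (C * ‖x₀ - x₀‖)) :=
      (by fun_prop : Continuous fun x => C * ‖x - x₀‖).tendsto x₀
    rw [sub_self, norm_zero, mul_zero] at this
    exact this.eventually_lt_const hε
  filter_upwards [h, hsmall] with x hx hs
  nlinarith [norm_nonneg (x - x₀)]

section Multipliers

variable {n m q : ℕ} {f : EuclideanSpace ℝ (Fin n) → EuclideanSpace ℝ (Fin m) → ℝ}
  {g : EuclideanSpace ℝ (Fin n) → EuclideanSpace ℝ (Fin m) → Fin q → ℝ}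

/-- The functional on `ℝⁿ × ℝᵐ` given by `τ • ∇f(x,y) + (v, 0)`. -/
noncomputable def liftFunctional
    (f : EuclideanSpace ℝ (Fin n) → EuclideanSpace ℝ (Fin m) → ℝ) (τ : ℝ)
    (v : EuclideanSpace ℝ (Fin n)) (p : EuclideanSpace ℝ (Fin n) × EuclideanSpace ℝ (Fin m)) :
    EuclideanSpace ℝ (Fin n) × EuclideanSpace ℝ (Fin m) →L[ℝ] ℝ :=
  τ • fderiv ℝ (fun p : EuclideanSpace ℝ (Fin n) × EuclideanSpace ℝ (Fin m) => f p.1 p.2) p +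
    (innerSL ℝ v).comp (ContinuousLinearMap.fst ℝ _ _)

theorem liftFunctional_apply (τ : ℝ) (v : EuclideanSpace ℝ (Fin n))
    (p d : EuclideanSpace ℝ (Fin n) × EuclideanSpace ℝ (Fin m)) :
    liftFunctional f τ v p d =
      τ * fderiv ℝ (fun p : EuclideanSpace ℝ (Fin n) × EuclideanSpace ℝ (Fin m) => f p.1 p.2) p d +
        ⟪v, d.1⟫ := by
  simp [liftFunctional]

/-- A subgradient of the negative value function lifts to an approximate normal to the graph of
the feasible map. -/
theorem liftFunctional_normal_of_mem_FSub {V : EuclideanSpace ℝ (Fin n) → ℝ}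
    (hf : ContDiff ℝ 1 (fun p : EuclideanSpace ℝ (Fin n) × EuclideanSpace ℝ (Fin m) => f p.1 p.2))
    (hV : ∀ x, ∀ y ∈ Feas g x, f x y ≤ V x)
    {x : EuclideanSpace ℝ (Fin n)} {y : EuclideanSpace ℝ (Fin m)} (hxy : f x y = V x)
    {v : EuclideanSpace ℝ (Fin n)} (hv : v ∈ FSub (fun x => ((-V x : ℝ) : EReal)) x)
    {ε : ℝ} (hε : 0 < ε) :
    ∀ᶠ z : EuclideanSpace ℝ (Fin n) × EuclideanSpace ℝ (Fin m) in 𝓝 (x, y),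
      (∀ i, g z.1 z.2 i ≤ 0) → liftFunctional f 1 v (x, y) (z - (x, y)) ≤ ε * ‖z - (x, y)‖ := by
  have h1 := (continuous_fst.tendsto (x, y)).eventually
    (mem_FSub_coe_iff.1 hv (ε / 2) (half_pos hε))
  have h2 := ((hf.differentiable (by simp)) (x, y)).hasFDerivAt.isLittleO.def (half_pos hε)
  filter_upwards [h1, h2] with z hz1 hz2 hz
  have h3 := hV z.1 z.2 hz
  have h4 : ‖z.1 - x‖ ≤ ‖z - (x, y)‖ := norm_fst_le (z - (x, y))
  rw [liftFunctional_apply, one_mul]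
  have h5 := (abs_le.1 (show |_| ≤ _ from hz2)).1
  simp only [Prod.fst_sub] at h5 ⊢
  nlinarith

/-- Limits of rescaled subgradients of the negative value function admit multipliers. -/
theorem exists_multiplier_of_tendsto_FSub {V : EuclideanSpace ℝ (Fin n) → ℝ}
    (hf : ContDiff ℝ 1 (fun p : EuclideanSpace ℝ (Fin n) × EuclideanSpace ℝ (Fin m) => f p.1 p.2))
    (hg : ∀ i, ContDiff ℝ 1
      (fun p : EuclideanSpace ℝ (Fin n) × EuclideanSpace ℝ (Fin m) => g p.1 p.2 i))
    {xb : EuclideanSpace ℝ (Fin n)} {yb : EuclideanSpace ℝ (Fin m)} {κ : ℝ} (hκ : 0 ≤ κ)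
    (heb : ∀ᶠ z : EuclideanSpace ℝ (Fin n) × EuclideanSpace ℝ (Fin m) in 𝓝 (xb, yb),
      infDist z {z : EuclideanSpace ℝ (Fin n) × EuclideanSpace ℝ (Fin m) |
        ∀ i, g z.1 z.2 i ≤ 0} ≤ κ * ∑ i, max (g z.1 z.2 i) 0)
    (hV : ∀ x, ∀ y ∈ Feas g x, f x y ≤ V x)
    {xk vk : ℕ → EuclideanSpace ℝ (Fin n)} {yk : ℕ → EuclideanSpace ℝ (Fin m)} {tk : ℕ → ℝ}
    {v : EuclideanSpace ℝ (Fin n)} {τ : ℝ}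
    (hyk : ∀ k, yk k ∈ Feas g (xk k)) (hVk : ∀ k, f (xk k) (yk k) = V (xk k))
    (hvk : ∀ k, vk k ∈ FSub (fun x => ((-V x : ℝ) : EReal)) (xk k))
    (htk : ∀ k, 0 ≤ tk k) (hx : Tendsto xk atTop (𝓝 xb)) (hy : Tendsto yk atTop (𝓝 yb))
    (ht : Tendsto tk atTop (𝓝 τ)) (hv : Tendsto (fun k => tk k • vk k) atTop (𝓝 v)) :
    ∃ lam : Fin q → ℝ, (∀ i, 0 ≤ lam i) ∧ (∀ i, lam i ≤ κ * ‖liftFunctional f τ v (xb, yb)‖) ∧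
      (∑ i, lam i * g xb yb i = 0) ∧
      v = ∑ i, lam i • gradx (fun x y => g x y i) xb yb - τ • gradx f xb yb ∧
      τ • grady f xb yb = ∑ i, lam i • grady (fun x y => g x y i) xb yb := by
  have hp : Tendsto (fun k => (xk k, yk k)) atTop (𝓝 (xb, yb)) := hx.prodMk_nhds hy
  have hgd : ∀ i p, DifferentiableAt ℝ
      (fun p : EuclideanSpace ℝ (Fin n) × EuclideanSpace ℝ (Fin m) => g p.1 p.2 i) p :=
    fun i p => (hg i).differentiable (by simp) p
  have hlift : Tendsto (fun k => liftFunctional f (tk k) (tk k • vk k) (xk k, yk k)) atTop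
      (𝓝 (liftFunctional f τ v (xb, yb))) := by
    refine (ht.smul (((hf.continuous_fderiv (by simp)).tendsto (xb, yb)).comp hp)).add ?_
    have hc : Continuous fun v : EuclideanSpace ℝ (Fin n) => (innerSL ℝ v).comp
        (ContinuousLinearMap.fst ℝ (EuclideanSpace ℝ (Fin n)) (EuclideanSpace ℝ (Fin m))) := by
      fun_prop
    exact (hc.tendsto v).comp hv
  have hact : ∀ᶠ k in atTop, ∀ i, g (xk k) (yk k) i = 0 → g xb yb i = 0 := by
    refine eventually_all.2 fun i => ?_
    by_cases hi : g xb yb i = 0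
    · simp [hi]
    · filter_upwards [(((hg i).continuous.tendsto (xb, yb)).comp hp).eventually_ne hi] with k hk h0
      exact absurd h0 hk
  have hle : ∀ d, liftFunctional f τ v (xb, yb) d ≤ κ * ‖liftFunctional f τ v (xb, yb)‖ *
      ∑ i, if g xb yb i = 0 then max (fderiv ℝ (fun p : EuclideanSpace ℝ (Fin n) ×
        EuclideanSpace ℝ (Fin m) => g p.1 p.2 i) (xb, yb) d) 0 else 0 := by
    intro d
    have hl : Tendsto (fun k => liftFunctional f (tk k) (tk k • vk k) (xk k, yk k) d) atTop
        (𝓝 (liftFunctional f τ v (xb, yb) d)) :=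
      ((ContinuousLinearMap.apply ℝ ℝ d).continuous.tendsto _).comp hlift
    have hr : Tendsto (fun k => κ * ‖liftFunctional f (tk k) (tk k • vk k) (xk k, yk k)‖ *
        ∑ i, if g xb yb i = 0 then max (fderiv ℝ (fun p : EuclideanSpace ℝ (Fin n) ×
          EuclideanSpace ℝ (Fin m) => g p.1 p.2 i) (xk k, yk k) d) 0 else 0) atTop
        (𝓝 (κ * ‖liftFunctional f τ v (xb, yb)‖ *
        ∑ i, if g xb yb i = 0 then max (fderiv ℝ (fun p : EuclideanSpace ℝ (Fin n) ×
          EuclideanSpace ℝ (Fin m) => g p.1 p.2 i) (xb, yb) d) 0 else 0)) := by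
      refine (hlift.norm.const_mul κ).mul (tendsto_finsetSum _ fun i _ => ?_)
      split_ifs
      · have h1 := (((hg i).continuous_fderiv (by simp)).tendsto (xb, yb)).comp hp
        exact (((ContinuousLinearMap.apply ℝ ℝ d).continuous.tendsto _).comp h1).max
          tendsto_const_nhds
      · exact tendsto_const_nhds
    refine le_of_tendsto_of_tendsto hl hr ?_
    filter_upwards [hp.eventually heb.eventually_nhds, hact] with k hk hak
    have h1 := apply_le_sum_max_of_errorBound (p := (xk k, yk k))
      (G := fun (p : EuclideanSpace ℝ (Fin n) × EuclideanSpace ℝ (Fin m)) i => g p.1 p.2 i) hκ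
      (hyk k) (fun i => (hgd i _).hasFDerivAt)
      (fun ε hε => liftFunctional_normal_of_mem_FSub hf hV (hVk k) (hvk k) hε) hk d
    have h2 : liftFunctional f (tk k) (tk k • vk k) (xk k, yk k) =
        tk k • liftFunctional f 1 (vk k) (xk k, yk k) := by
      ext <;> simp [liftFunctional]
    rw [h2, norm_smul, Real.norm_of_nonneg (htk k), smul_apply, smul_eq_mul]
    have h3 : κ * (tk k * ‖liftFunctional f 1 (vk k) (xk k, yk k)‖) =
        tk k * (κ * ‖liftFunctional f 1 (vk k) (xk k, yk k)‖) := by ring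
    rw [h3, mul_assoc]
    refine mul_le_mul_of_nonneg_left (h1.trans ?_) (htk k)
    gcongr with i
    by_cases h0 : g (xk k) (yk k) i = 0
    · simp [h0, hak i h0]
    · simp only [h0, if_false]
      split_ifs <;> simp
  obtain ⟨lam, h0, h1, h2, h3, h4⟩ := exists_multiplier_of_le_sum_max
    (fun i => gradx (fun x y => g x y i) xb yb) (fun i => grady (fun x y => g x y i) xb yb)
    (τ • gradx f xb yb + v) (τ • grady f xb yb) (fun i => g xb yb i = 0)
    (M := κ * ‖liftFunctional f τ v (xb, yb)‖) (by positivity) (by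
      intro d e
      have h := hle (d, e)
      rw [liftFunctional_apply, fderiv_uncurry_apply (hf.differentiable (by simp) _)] at h
      simp only [fun i => fderiv_uncurry_apply (φ := fun x y => g x y i) (hgd i (xb, yb)) d e] at h
      rw [inner_add_left, inner_smul_left, inner_smul_left]
      simp only [conj_trivial]
      linarith)
  refine ⟨lam, h0, h1, Finset.sum_eq_zero fun i _ => ?_, ?_, h4⟩
  · by_cases hi : g xb yb i = 0
    · rw [hi, mul_zero]
    · rw [h2 i hi, zero_mul]
  · rw [← h3, add_sub_cancel_left]

end Multipliers

section Variational

variable {n : ℕ} {x₀ : EuclideanSpace ℝ (Fin n)}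

/-- A trivial horizon subdifferential bounds the Fréchet subgradients at nearby points. -/
theorem exists_FSub_bound {φ : EuclideanSpace ℝ (Fin n) → EReal} (hφ : ContinuousAt φ x₀)
    (h : HorSub φ x₀ ⊆ {0}) :
    ∃ L r : ℝ, 0 < r ∧ ∀ z ∈ ball x₀ r, ∀ u ∈ FSub φ z, ‖u‖ ≤ L := by
  by_contra! hcon
  have hex : ∀ k : ℕ, ∃ z ∈ ball x₀ (1 / ((k : ℝ) + 1)), ∃ u ∈ FSub φ z, (k : ℝ) + 1 < ‖u‖ :=
    fun k => hcon _ _ (by positivity)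
  choose z hz u hu hlt using hex
  have hz₀ : Tendsto z atTop (𝓝 x₀) := tendsto_iff_dist_tendsto_zero.2
    (squeeze_zero (fun _ => dist_nonneg) (fun k => (hz k).le)
      tendsto_one_div_add_atTop_nhds_zero_nat)
  have hpos : ∀ k, 0 < ‖u k‖ := fun k => lt_trans (by positivity) (hlt k)
  have hunit : ∀ k, ‖u k‖⁻¹ • u k ∈ sphere (0 : EuclideanSpace ℝ (Fin n)) 1 := fun k => by
    rw [mem_sphere_zero_iff_norm, norm_smul, norm_inv, norm_norm, inv_mul_cancel₀ (hpos k).ne']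
  obtain ⟨v, hv, ψ, hψ, hlim⟩ := (isCompact_sphere _ _).tendsto_subseq hunit
  have ht : Tendsto (fun k => ‖u k‖⁻¹) atTop (𝓝 0) :=
    squeeze_zero (fun k => (inv_pos.2 (hpos k)).le)
      (fun k => by
        rw [← one_div]
        exact one_div_le_one_div_of_le (by positivity) (hlt k).le)
      tendsto_one_div_add_atTop_nhds_zero_nat
  have hv0 : v ∈ HorSub φ x₀ := ⟨z ∘ ψ, u ∘ ψ, fun k => ‖u (ψ k)‖⁻¹, fun k => hu _,
    fun k => inv_pos.2 (hpos _), ht.comp hψ.tendsto_atTop, hz₀.comp hψ.tendsto_atTop,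
    hφ.tendsto.comp (hz₀.comp hψ.tendsto_atTop), hlim⟩
  rw [h hv0, mem_sphere_zero_iff_norm, norm_zero] at hv
  exact zero_ne_one hv

/-- Bounded Fréchet subgradients near a point of continuity give local Lipschitz continuity. -/
theorem exists_lipschitzOnWith_of_FSub_bound {φ : EuclideanSpace ℝ (Fin n) → ℝ} {L r : ℝ}
    (hr : 0 < r) (hφ : ContinuousAt φ x₀) (hlsc : LowerSemicontinuousOn φ (ball x₀ r))
    (hL : ∀ z ∈ ball x₀ r, ∀ u ∈ FSub (fun x => (φ x : EReal)) z, ‖u‖ ≤ L) :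
    ∃ δ > 0, ∃ K : NNReal, LipschitzOnWith K φ (ball x₀ δ) := by
  obtain ⟨s, hs, hosc⟩ := Metric.continuousAt_iff.1 hφ 1 one_pos
  set ρ := min s r / 4 with hρ
  have hρ0 : 0 < ρ := by positivity
  have hρs : 4 * ρ ≤ s := by rw [hρ]; linarith [min_le_left s r]
  have hρr : 4 * ρ ≤ r := by rw [hρ]; linarith [min_le_right s r]
  set K : ℝ := |L| + 1 / ρ + 1 with hK
  have hK0 : 0 < K := by positivity
  have hKρ : 1 ≤ K * ρ := by
    have : 1 / ρ * ρ = 1 := by field_simp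
    nlinarith [abs_nonneg L]
  have hLK : L < K := by
    have : 0 < 1 / ρ := by positivity
    linarith [le_abs_self L]
  have main : ∀ x ∈ ball x₀ ρ, ∀ z ∈ ball x₀ ρ, φ x ≤ φ z + K * dist z x := by
    intro x hx z hz
    have hsub : ∀ y ∈ closedBall x (2 * ρ), dist y x₀ < 4 * ρ := fun y hy => by
      have := dist_triangle y x x₀
      rw [mem_closedBall] at hy
      rw [mem_ball] at hx
      linarith
    have hlsc' : LowerSemicontinuousOn (fun y => φ y + K * dist y x) (closedBall x (2 * ρ)) :=
      (hlsc.mono fun y hy => (hsub y hy).trans_le hρr).add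
        ((by fun_prop : Continuous fun y => K * dist y x).lowerSemicontinuous.lowerSemicontinuousOn _)
    obtain ⟨y, hy, hmin⟩ := hlsc'.exists_isMinOn
      ⟨x, mem_closedBall_self (by positivity)⟩ (isCompact_closedBall _ _)
    have hyx : y = x := by
      by_contra hne
      have hd : 0 < ‖y - x‖ := norm_pos_iff.2 (sub_ne_zero.2 hne)
      have h1 : φ y + K * dist y x ≤ φ x + K * dist x x :=
        hmin (mem_closedBall_self (by positivity))
      rw [dist_self, mul_zero, add_zero, dist_eq_norm] at h1
      have h2 := (abs_lt.1 (hosc (show dist y x₀ < s from (hsub y hy).trans_le hρs))).1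
      have h3 := (abs_lt.1 (hosc (show dist x x₀ < s by rw [mem_ball] at hx; linarith))).2
      have h4 : ‖y - x‖ < 2 * ρ := by
        by_contra! h5
        nlinarith
      have hnhds : closedBall x (2 * ρ) ∈ 𝓝 y :=
        closedBall_mem_nhds_of_mem (by rwa [mem_ball, dist_eq_norm])
      have hmem : (-(K / ‖y - x‖)) • (y - x) ∈ FSub (fun x => (φ x : EReal)) y := by
        refine mem_FSub_of_proximal (C := K / (2 * ‖y - x‖)) ?_
        filter_upwards [hnhds] with w hw
        have h5 : φ y + K * dist y x ≤ φ w + K * dist w x := hmin hw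
        rw [dist_eq_norm, dist_eq_norm] at h5
        have h6 : ‖w - x‖ ^ 2 = ‖w - y‖ ^ 2 + 2 * ⟪y - x, w - y⟫ + ‖y - x‖ ^ 2 := by
          have : w - x = (w - y) + (y - x) := by abel
          rw [this, norm_add_sq_real, real_inner_comm]
        have h7 : ‖w - x‖ ≤ ‖y - x‖ + ⟪y - x, w - y⟫ / ‖y - x‖ +
            ‖w - y‖ ^ 2 / (2 * ‖y - x‖) := by
          have h8 : ‖y - x‖ + ⟪y - x, w - y⟫ / ‖y - x‖ + ‖w - y‖ ^ 2 / (2 * ‖y - x‖) =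
              (‖w - x‖ ^ 2 + ‖y - x‖ ^ 2) / (2 * ‖y - x‖) := by
            rw [h6]
            field_simp
            ring
          rw [h8, le_div_iff₀ (by positivity)]
          nlinarith [sq_nonneg (‖w - x‖ - ‖y - x‖)]
        have h9 := mul_le_mul_of_nonneg_left h7 hK0.le
        rw [inner_smul_left, conj_trivial]
        have h10 : K * (‖y - x‖ + ⟪y - x, w - y⟫ / ‖y - x‖ + ‖w - y‖ ^ 2 / (2 * ‖y - x‖)) =
            K * ‖y - x‖ + K / ‖y - x‖ * ⟪y - x, w - y⟫ + K / (2 * ‖y - x‖) * ‖w - y‖ ^ 2 := by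
          ring
        linarith
      have h11 := hL y ((hsub y hy).trans_le hρr) _ hmem
      rw [norm_smul, norm_neg, Real.norm_of_nonneg (by positivity), div_mul_cancel₀ _ hd.ne'] at h11
      linarith
    have hzx : z ∈ closedBall x (2 * ρ) := by
      have := dist_triangle_right z x x₀
      rw [mem_ball] at hx hz
      rw [mem_closedBall]
      linarith
    have h1 : φ y + K * dist y x ≤ φ z + K * dist z x := hmin hzx
    rwa [hyx, dist_self, mul_zero, add_zero] at h1
  refine ⟨ρ, hρ0, K.toNNReal, LipschitzOnWith.of_dist_le_mul fun x hx z hz => ?_⟩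
  have h1 := main x hx z hz
  have h2 := main z hz x hx
  rw [dist_comm z x] at h1
  rw [Real.dist_eq, Real.coe_toNNReal _ hK0.le, abs_le]
  constructor <;> linarith

/-- A one-sided mean value inequality in terms of Fréchet subgradients. -/
theorem sub_le_mul_of_inner_FSub_le {φ : EuclideanSpace ℝ (Fin n) → ℝ} {K : NNReal} {r c : ℝ}
    {d : EuclideanSpace ℝ (Fin n)} (hLip : LipschitzOnWith K φ (ball x₀ r))
    (hc : ∀ z ∈ ball x₀ r, ∀ u ∈ FSub (fun x => (φ x : EReal)) z, ⟪u, d⟫ ≤ c)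
    {x : EuclideanSpace ℝ (Fin n)} {t : ℝ} (ht : 0 < t) (hxt : ‖x - x₀‖ + t * ‖d‖ < r) :
    φ (x + t • d) - φ x ≤ t * c := by
  by_contra! hcon
  obtain ⟨c', hcc', hc'⟩ := exists_between ((lt_div_iff₀' ht).2 hcon)
  rw [lt_div_iff₀' ht] at hc'
  set gap := φ (x + t • d) - φ x - t * c' with hgap
  have hgap0 : 0 < gap := by linarith
  set ρ := (r - ‖x - x₀‖ - t * ‖d‖) / 2 with hρ
  have hρ0 : 0 < ρ := by rw [hρ]; linarith
  set N : ℝ := (K * (t * ‖d‖ + ρ) + |c'| * t) / ρ ^ 2 + K ^ 2 / (4 * gap) + 1 with hN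
  have hN0 : 0 < N := by positivity
  have hNρ : K * (t * ‖d‖ + ρ) + |c'| * t < N * ρ ^ 2 := by
    have h1 : (K * (t * ‖d‖ + ρ) + |c'| * t) / ρ ^ 2 * ρ ^ 2 = K * (t * ‖d‖ + ρ) + |c'| * t := by
      field_simp
    have h2 : 0 < (K ^ 2 / (4 * gap) + 1) * ρ ^ 2 := by positivity
    nlinarith
  have hNgap : (K : ℝ) ^ 2 < 4 * N * gap := by
    have h1 : (K : ℝ) ^ 2 / (4 * gap) * (4 * gap) = K ^ 2 := by field_simp
    have h2 : 0 < ((K * (t * ‖d‖ + ρ) + |c'| * t) / ρ ^ 2 + 1) * (4 * gap) := by positivity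
    nlinarith
  have hball : ∀ s ∈ Set.Icc 0 t, ∀ e : EuclideanSpace ℝ (Fin n), ‖e‖ ≤ ρ →
      x + s • d + e ∈ ball x₀ r := by
    intro s hs e he
    rw [mem_ball, dist_eq_norm]
    have h1 : x + s • d + e - x₀ = (x - x₀) + s • d + e := by abel
    have h2 := norm_add₃_le (a := x - x₀) (b := s • d) (c := e)
    rw [norm_smul, Real.norm_of_nonneg hs.1] at h2
    have h3 : s * ‖d‖ ≤ t * ‖d‖ := by gcongr; exact hs.2
    rw [h1]
    linarith
  set H : EuclideanSpace ℝ (Fin n) × ℝ → ℝ :=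
    fun p => φ (x + p.2 • d + p.1) - c' * p.2 + N * ‖p.1‖ ^ 2 with hH
  have hcont : ContinuousOn H (closedBall 0 ρ ×ˢ Set.Icc 0 t) := by
    have h1 : ContinuousOn (fun p : EuclideanSpace ℝ (Fin n) × ℝ => φ (x + p.2 • d + p.1))
        (closedBall 0 ρ ×ˢ Set.Icc 0 t) :=
      hLip.continuousOn.comp (by fun_prop)
        fun p hp => hball p.2 hp.2 p.1 (mem_closedBall_zero_iff.1 hp.1)
    exact (h1.sub (by fun_prop)).add (by fun_prop)
  have h0mem : ((0 : EuclideanSpace ℝ (Fin n)), (0 : ℝ)) ∈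
      closedBall (0 : EuclideanSpace ℝ (Fin n)) ρ ×ˢ Set.Icc 0 t :=
    ⟨mem_closedBall_self hρ0.le, le_rfl, ht.le⟩
  obtain ⟨⟨e, s⟩, ⟨he, hs⟩, hmin⟩ :=
    ((isCompact_closedBall _ _).prod isCompact_Icc).exists_isMinOn ⟨_, h0mem⟩ hcont
  simp only at he hs
  rw [mem_closedBall_zero_iff] at he
  have hmin0 : φ (x + s • d + e) - c' * s + N * ‖e‖ ^ 2 ≤ φ x := by
    simpa [hH] using hmin h0mem
  have heρ : ‖e‖ < ρ := by
    refine lt_of_le_of_ne he fun heq => ?_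
    have h1 := hLip.dist_le_mul _ (hball s hs e he) x
      (by simpa using hball 0 ⟨le_rfl, ht.le⟩ 0 (by simpa using hρ0.le))
    have h2 : dist (x + s • d + e) x ≤ t * ‖d‖ + ρ := by
      rw [dist_eq_norm, show x + s • d + e - x = s • d + e by abel]
      refine (norm_add_le _ _).trans ?_
      rw [norm_smul, Real.norm_of_nonneg hs.1]
      gcongr
      exact hs.2
    have h3 := mul_le_mul_of_nonneg_left h2 K.2
    have h4 := (abs_le.1 h1).1
    have h5 : c' * s ≤ |c'| * t :=
      mul_le_mul (le_abs_self _) hs.2 hs.1 (abs_nonneg _)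
    rw [heq] at hmin0
    have h6 : (K : ℝ) * dist (x + s • d + e) x ≤ K * (t * ‖d‖ + ρ) := h3
    linarith
  have hst : s < t := by
    refine lt_of_le_of_ne hs.2 fun heq => ?_
    subst heq
    have h1 := hLip.dist_le_mul _ (hball s hs e he) (x + s • d)
      (by simpa using hball s hs 0 (by simpa using hρ0.le))
    rw [dist_eq_norm (x + s • d + e), add_sub_cancel_left] at h1
    have h2 := (abs_le.1 h1).1
    nlinarith [sq_nonneg (2 * N * ‖e‖ - K)]
  have hsub : (-(2 * N)) • e ∈ FSub (fun x => (φ x : EReal)) (x + s • d + e) := by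
    refine mem_FSub_of_proximal (C := N) ?_
    have hev : ∀ᶠ z in 𝓝 (x + s • d + e), ‖z - (x + s • d)‖ < ρ := by
      have : Tendsto (fun z => ‖z - (x + s • d)‖) (𝓝 (x + s • d + e))
          (𝓝 ‖x + s • d + e - (x + s • d)‖) :=
        (by fun_prop : Continuous fun z => ‖z - (x + s • d)‖).tendsto _
      rw [add_sub_cancel_left] at this
      exact this.eventually_lt_const heρ
    filter_upwards [hev] with z hz
    have h1 : H (e, s) ≤ H (z - (x + s • d), s) :=
      hmin ⟨mem_closedBall_zero_iff.2 hz.le, hs⟩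
    simp only [hH, add_sub_cancel] at h1
    have h2 : ‖z - (x + s • d)‖ ^ 2 =
        ‖e‖ ^ 2 + 2 * ⟪e, z - (x + s • d + e)⟫ + ‖z - (x + s • d + e)‖ ^ 2 := by
      have : z - (x + s • d) = e + (z - (x + s • d + e)) := by abel
      rw [this, norm_add_sq_real]
    rw [inner_smul_left, conj_trivial]
    nlinarith
  have hlow : c' ≤ -(2 * N) * ⟪e, d⟫ := by
    have hlim : Tendsto (fun h : ℝ => -(2 * N) * ⟪e, d⟫ + N * h * ‖d‖ ^ 2) (𝓝[>] 0)
        (𝓝 (-(2 * N) * ⟪e, d⟫)) := by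
      have : Tendsto (fun h : ℝ => -(2 * N) * ⟪e, d⟫ + N * h * ‖d‖ ^ 2) (𝓝 0)
          (𝓝 (-(2 * N) * ⟪e, d⟫ + N * 0 * ‖d‖ ^ 2)) :=
        (by fun_prop : Continuous fun h : ℝ => -(2 * N) * ⟪e, d⟫ + N * h * ‖d‖ ^ 2).tendsto 0
      rw [mul_zero, zero_mul, add_zero] at this
      exact this.mono_left nhdsWithin_le_nhds
    refine ge_of_tendsto hlim ?_
    have h1 : ∀ᶠ h : ℝ in 𝓝 0, ‖e - h • d‖ < ρ := by
      have : Tendsto (fun h : ℝ => ‖e - h • d‖) (𝓝 0) (𝓝 ‖e - (0 : ℝ) • d‖) :=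
        (by fun_prop : Continuous fun h : ℝ => ‖e - h • d‖).tendsto 0
      rw [zero_smul, sub_zero] at this
      exact this.eventually_lt_const heρ
    filter_upwards [h1.filter_mono nhdsWithin_le_nhds, self_mem_nhdsWithin,
      Ioo_mem_nhdsGT (sub_pos.2 hst)] with h hh hpos hlt
    have hpos : 0 < h := hpos
    have h2 : H (e, s) ≤ H (e - h • d, s + h) :=
      hmin ⟨mem_closedBall_zero_iff.2 hh.le, by linarith [hs.1], by linarith [hlt.2]⟩
    have h3 : x + (s + h) • d + (e - h • d) = x + s • d + e := by
      rw [add_smul]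
      abel
    simp only [hH, h3] at h2
    rw [norm_sub_sq_real, inner_smul_right, norm_smul, Real.norm_of_nonneg hpos.le] at h2
    refine le_of_mul_le_mul_left ?_ hpos
    nlinarith
  have hup := hc _ (hball s hs e he) _ hsub
  rw [inner_smul_left, conj_trivial] at hup
  linarith

/-- The limiting subgradients of `-φ` lie in the support half-spaces of `-∂φ`. -/
theorem inner_neg_le_of_mem_LSub_neg {φ : EuclideanSpace ℝ (Fin n) → ℝ} {K : NNReal} {r L c : ℝ}
    (hr : 0 < r) {d w : EuclideanSpace ℝ (Fin n)} (hLip : LipschitzOnWith K φ (ball x₀ r))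
    (hL : ∀ z ∈ ball x₀ r, ∀ u ∈ FSub (fun x => (φ x : EReal)) z, ‖u‖ ≤ L)
    (hc : ∀ u ∈ LSub (fun x => (φ x : EReal)) x₀, ⟪u, d⟫ ≤ c)
    (hw : w ∈ LSub (fun x => ((-φ x : ℝ) : EReal)) x₀) :
    ⟪-w, d⟫ ≤ c := by
  refine le_of_forall_pos_le_add fun η hη => ?_
  have hcontφ : ContinuousAt (fun x => (φ x : EReal)) x₀ :=
    continuous_coe_real_ereal.continuousAt.comp
      (hLip.continuousOn.continuousAt (ball_mem_nhds _ hr))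
  obtain ⟨s, hs, hsr, hbound⟩ : ∃ s > 0, s ≤ r ∧
      ∀ z ∈ ball x₀ s, ∀ u ∈ FSub (fun x => (φ x : EReal)) z, ⟪u, d⟫ ≤ c + η := by
    by_contra! hcon
    have hex : ∀ k : ℕ, ∃ z ∈ ball x₀ (min r (1 / ((k : ℝ) + 1))),
        ∃ u ∈ FSub (fun x => (φ x : EReal)) z, c + η < ⟪u, d⟫ :=
      fun k => hcon _ (lt_min hr (by positivity)) (min_le_left _ _)
    choose z hz u hu hlt using hex
    have hz₀ : Tendsto z atTop (𝓝 x₀) := tendsto_iff_dist_tendsto_zero.2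
      (squeeze_zero (fun _ => dist_nonneg) (fun k => (hz k).le.trans (min_le_right _ _))
        tendsto_one_div_add_atTop_nhds_zero_nat)
    have hub : ∀ k, u k ∈ closedBall (0 : EuclideanSpace ℝ (Fin n)) L := fun k =>
      mem_closedBall_zero_iff.2 (hL _ (ball_subset_ball (min_le_left _ _) (hz k)) _ (hu k))
    obtain ⟨v, -, ψ, hψ, hlim⟩ := (isCompact_closedBall _ _).tendsto_subseq hub
    have hv := hc v ⟨z ∘ ψ, u ∘ ψ, fun k => hu _, hz₀.comp hψ.tendsto_atTop,
      hcontφ.tendsto.comp (hz₀.comp hψ.tendsto_atTop), hlim⟩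
    have hge : c + η ≤ ⟪v, d⟫ :=
      ge_of_tendsto (hlim.inner tendsto_const_nhds) (Eventually.of_forall fun k => (hlt _).le)
    linarith
  obtain ⟨xk, wk, hwk, hxk, -, hwlim⟩ := hw
  have hev : ∀ᶠ k in atTop, ⟪-wk k, d⟫ ≤ c + η := by
    filter_upwards [hxk.eventually (ball_mem_nhds x₀ hs)] with k hk
    rw [dist_eq_norm] at hk
    refine le_of_forall_pos_le_add fun ε hε => ?_
    have hε' : 0 < ε / (‖d‖ + 1) := by positivity
    have h1 : ∀ᶠ t : ℝ in 𝓝[>] 0, (-φ (xk k)) + ⟪wk k, xk k - t • d - xk k⟫ -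
        ε / (‖d‖ + 1) * ‖xk k - t • d - xk k‖ ≤ -φ (xk k - t • d) := by
      have : Tendsto (fun t : ℝ => xk k - t • d) (𝓝 0) (𝓝 (xk k - (0 : ℝ) • d)) :=
        (by fun_prop : Continuous fun t : ℝ => xk k - t • d).tendsto 0
      rw [zero_smul, sub_zero] at this
      exact (this.mono_left nhdsWithin_le_nhds).eventually (mem_FSub_coe_iff.1 (hwk k) _ hε')
    have h2 : ∀ᶠ t : ℝ in 𝓝[>] 0, ‖xk k - t • d - x₀‖ + t * ‖d‖ < s := by
      have : Tendsto (fun t : ℝ => ‖xk k - t • d - x₀‖ + t * ‖d‖) (𝓝 0)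
          (𝓝 (‖xk k - (0 : ℝ) • d - x₀‖ + 0 * ‖d‖)) :=
        (by fun_prop : Continuous fun t : ℝ => ‖xk k - t • d - x₀‖ + t * ‖d‖).tendsto 0
      rw [zero_smul, sub_zero, zero_mul, add_zero] at this
      exact (this.mono_left nhdsWithin_le_nhds).eventually_lt_const hk
    obtain ⟨t, ht1, ht2, ht⟩ := (h1.and (h2.and self_mem_nhdsWithin)).exists
    have ht : 0 < t := ht
    have h3 := sub_le_mul_of_inner_FSub_le (hLip.mono (ball_subset_ball hsr)) hbound ht ht2
    rw [sub_add_cancel] at h3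
    rw [show xk k - t • d - xk k = -(t • d) by abel, norm_neg, norm_smul,
      Real.norm_of_nonneg ht.le, inner_neg_right, inner_smul_right] at ht1
    have h4 : ε / (‖d‖ + 1) * (t * ‖d‖) ≤ t * ε := by
      have : ε / (‖d‖ + 1) * (‖d‖ + 1) = ε := by field_simp
      nlinarith [mul_pos ht hε']
    rw [inner_neg_left]
    refine le_of_mul_le_mul_left ?_ ht
    nlinarith
  exact le_of_tendsto (hwlim.neg.inner tendsto_const_nhds) hev

theorem norm_le_of_mem_LSub {φ : EuclideanSpace ℝ (Fin n) → EReal} {r L : ℝ} (hr : 0 < r)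
    (hL : ∀ z ∈ ball x₀ r, ∀ u ∈ FSub φ z, ‖u‖ ≤ L) {v : EuclideanSpace ℝ (Fin n)}
    (hv : v ∈ LSub φ x₀) : ‖v‖ ≤ L := by
  obtain ⟨xk, vk, hvk, hxk, -, hlim⟩ := hv
  refine le_of_tendsto hlim.norm ?_
  filter_upwards [hxk.eventually (ball_mem_nhds x₀ hr)] with k hk using hL _ hk _ (hvk k)

end Variational

section ValueFunction

variable {n m q : ℕ} {f : EuclideanSpace ℝ (Fin n) → EuclideanSpace ℝ (Fin m) → ℝ}
  {g : EuclideanSpace ℝ (Fin n) → EuclideanSpace ℝ (Fin m) → Fin q → ℝ}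
  {xb : EuclideanSpace ℝ (Fin n)} {yb : EuclideanSpace ℝ (Fin m)}

theorem InnerSemicont.nonempty_Sol (h : InnerSemicont f g xb yb) (x : EuclideanSpace ℝ (Fin n)) :
    (Sol f g x).Nonempty := by
  obtain ⟨y, hy, -⟩ := h (fun k => if k = 0 then x else xb) (by
    refine tendsto_const_nhds.congr' ?_
    filter_upwards [eventually_ne_atTop 0] with k hk
    simp [hk])
  exact ⟨y 0, hy 0⟩

theorem InnerSemicont.exists_real_valueFunction (h : InnerSemicont f g xb yb) :
    ∃ V : EuclideanSpace ℝ (Fin n) → ℝ, Vfun f g = fun x => (V x : EReal) := by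
  choose y hy using h.nonempty_Sol
  exact ⟨fun x => f x (y x), funext fun x => (hy x).2.symm⟩

variable {V : EuclideanSpace ℝ (Fin n) → ℝ}

theorem le_of_mem_Feas (hV : Vfun f g = fun x => (V x : EReal)) (x : EuclideanSpace ℝ (Fin n))
    (y : EuclideanSpace ℝ (Fin m)) (hy : y ∈ Feas g x) : f x y ≤ V x := by
  have h : (f x y : EReal) ≤ Vfun f g x := le_sSup ⟨y, hy, rfl⟩
  rw [hV] at h
  exact EReal.coe_le_coe_iff.1 h

theorem eq_of_mem_Sol (hV : Vfun f g = fun x => (V x : EReal)) {x : EuclideanSpace ℝ (Fin n)}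
    {y : EuclideanSpace ℝ (Fin m)} (hy : y ∈ Sol f g x) : f x y = V x := by
  have h := hy.2
  rw [hV] at h
  exact EReal.coe_eq_coe_iff.1 h

theorem InnerSemicont.continuousAt
    (hf : ContDiff ℝ 1 (fun p : EuclideanSpace ℝ (Fin n) × EuclideanSpace ℝ (Fin m) => f p.1 p.2))
    (hyb : yb ∈ Sol f g xb) (h : InnerSemicont f g xb yb)
    (hV : Vfun f g = fun x => (V x : EReal)) : ContinuousAt V xb := by
  refine tendsto_of_seq_tendsto fun xk hxk => ?_
  obtain ⟨yk, hyk, hlim⟩ := h xk hxk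
  rw [← eq_of_mem_Sol hV hyb]
  exact ((hf.continuous.tendsto (xb, yb)).comp (hxk.prodMk_nhds hlim)).congr
    fun k => eq_of_mem_Sol hV (hyk k)

theorem InnerSemicont.exists_lowerSemicontinuousOn_neg
    (hf : ContDiff ℝ 1 (fun p : EuclideanSpace ℝ (Fin n) × EuclideanSpace ℝ (Fin m) => f p.1 p.2))
    (hg : ∀ i, ContDiff ℝ 1
      (fun p : EuclideanSpace ℝ (Fin n) × EuclideanSpace ℝ (Fin m) => g p.1 p.2 i))
    (h : InnerSemicont f g xb yb) (hV : Vfun f g = fun x => (V x : EReal)) :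
    ∃ r > 0, LowerSemicontinuousOn (fun x => -V x) (ball xb r) := by
  have hev : ∀ᶠ x in 𝓝 xb, ∃ y ∈ Sol f g x, y ∈ closedBall yb 1 := by
    by_contra hcon
    obtain ⟨xk, hxk, hno⟩ := exists_seq_forall_of_frequently (not_eventually.1 hcon)
    obtain ⟨yk, hyk, hlim⟩ := h xk hxk
    obtain ⟨k, hk⟩ := (hlim.eventually (closedBall_mem_nhds yb one_pos)).exists
    exact hno k ⟨yk k, hyk k, hk⟩
  obtain ⟨r, hr, hball⟩ := Metric.eventually_nhds_iff_ball.1 hev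
  refine ⟨r, hr, fun x hx c hc => ?_⟩
  by_contra hcon
  obtain ⟨xk, hxk, hno⟩ := exists_seq_forall_of_frequently
    ((not_eventually.1 hcon).and_eventually self_mem_nhdsWithin)
  choose yk hyk hyb using fun k => hball (xk k) (hno k).2
  obtain ⟨y, -, ψ, hψ, hlim⟩ := (isCompact_closedBall yb 1).tendsto_subseq hyb
  have hp : Tendsto (fun k => (xk (ψ k), yk (ψ k))) atTop (𝓝 (x, y)) :=
    ((hxk.mono_right nhdsWithin_le_nhds).comp hψ.tendsto_atTop).prodMk_nhds hlim
  have hy : y ∈ Feas g x := fun i =>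
    le_of_tendsto (((hg i).continuous.tendsto (x, y)).comp hp)
      (Eventually.of_forall fun k => (hyk (ψ k)).1 i)
  have hle : -c ≤ f x y := by
    refine ge_of_tendsto ((hf.continuous.tendsto (x, y)).comp hp) (Eventually.of_forall fun k => ?_)
    have h1 := (hno (ψ k)).1
    have h2 : f (xk (ψ k)) (yk (ψ k)) = V (xk (ψ k)) := eq_of_mem_Sol hV (hyk (ψ k))
    simp only [Function.comp_apply, h2]
    linarith [not_lt.1 h1]
  linarith [le_of_mem_Feas hV x y hy]

theorem LocalErrorBound.eventually (h : LocalErrorBound g xb yb) :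
    ∃ κ : ℝ, 0 ≤ κ ∧
      ∀ᶠ z : EuclideanSpace ℝ (Fin n) × EuclideanSpace ℝ (Fin m) in 𝓝 (xb, yb),
        infDist z {z : EuclideanSpace ℝ (Fin n) × EuclideanSpace ℝ (Fin m) |
          ∀ i, g z.1 z.2 i ≤ 0} ≤ κ * ∑ i, max (g z.1 z.2 i) 0 := by
  obtain ⟨κ, δ, hκ, hδ, h⟩ := h
  refine ⟨κ, hκ.le, Metric.eventually_nhds_iff.2 ⟨δ, hδ, fun z hz => h z.1 z.2 ?_⟩⟩
  rwa [dist_eq_norm] at hz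

/-- The limiting subgradients of `-V` come from multipliers that are uniformly bounded on bounded
sets of subgradients. -/
theorem exists_bounded_multiplier_of_mem_LSub
    (hf : ContDiff ℝ 1 (fun p : EuclideanSpace ℝ (Fin n) × EuclideanSpace ℝ (Fin m) => f p.1 p.2))
    (hg : ∀ i, ContDiff ℝ 1
      (fun p : EuclideanSpace ℝ (Fin n) × EuclideanSpace ℝ (Fin m) => g p.1 p.2 i))
    (hyb : yb ∈ Feas g xb) (hisc : InnerSemicont f g xb yb) (heb : LocalErrorBound g xb yb)
    (hV : Vfun f g = fun x => (V x : EReal)) :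
    ∃ κ : ℝ, 0 ≤ κ ∧ ∀ v ∈ LSub (fun x => ((-V x : ℝ) : EReal)) xb,
      ∃ lam ∈ SigmaSet f g xb yb, (∀ i, lam i ≤ κ * ‖liftFunctional f 1 v (xb, yb)‖) ∧
        v = -gradxL f g xb yb lam := by
  obtain ⟨κ, hκ, hev⟩ := heb.eventually
  refine ⟨κ, hκ, fun v ⟨xk, vk, hvk, hxk, _, hvlim⟩ => ?_⟩
  obtain ⟨yk, hyk, hylim⟩ := hisc xk hxk
  obtain ⟨lam, h0, h1, h2, h3, h4⟩ := exists_multiplier_of_tendsto_FSub hf hg hκ hev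
    (le_of_mem_Feas hV) (fun k => (hyk k).1) (fun k => eq_of_mem_Sol hV (hyk k)) hvk
    (tk := fun _ => 1) (fun _ => zero_le_one) hxk hylim tendsto_const_nhds (by simpa using hvlim)
  rw [one_smul] at h3 h4
  refine ⟨lam, ⟨?_, h0, hyb, h2⟩, h1, ?_⟩
  · rw [gradyL_eq hf hg, h4, sub_self]
  · rw [gradxL_eq hf hg, h3, neg_sub]

theorem HorSub_neg_subset
    (hf : ContDiff ℝ 1 (fun p : EuclideanSpace ℝ (Fin n) × EuclideanSpace ℝ (Fin m) => f p.1 p.2))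
    (hg : ∀ i, ContDiff ℝ 1
      (fun p : EuclideanSpace ℝ (Fin n) × EuclideanSpace ℝ (Fin m) => g p.1 p.2 i))
    (hyb : yb ∈ Feas g xb) (hisc : InnerSemicont f g xb yb) (heb : LocalErrorBound g xb yb)
    (hV : Vfun f g = fun x => (V x : EReal)) :
    HorSub (fun x => ((-V x : ℝ) : EReal)) xb ⊆
      {v | ∃ lam ∈ SigmaZero g xb yb,
        v = ∑ i, lam i • gradx (fun x y => g x y i) xb yb} := by
  obtain ⟨κ, hκ, hev⟩ := heb.eventually
  rintro v ⟨xk, vk, tk, hvk, htk, htlim, hxk, -, hvlim⟩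
  obtain ⟨yk, hyk, hylim⟩ := hisc xk hxk
  obtain ⟨lam, h0, -, h2, h3, h4⟩ := exists_multiplier_of_tendsto_FSub hf hg hκ hev
    (le_of_mem_Feas hV) (fun k => (hyk k).1) (fun k => eq_of_mem_Sol hV (hyk k)) hvk
    (fun k => (htk k).le) hxk hylim htlim hvlim
  rw [zero_smul] at h4
  rw [zero_smul, sub_zero] at h3
  exact ⟨lam, ⟨h4.symm, h0, hyb, h2⟩, h3⟩

theorem convex_SigmaSet
    (hf : ContDiff ℝ 1 (fun p : EuclideanSpace ℝ (Fin n) × EuclideanSpace ℝ (Fin m) => f p.1 p.2))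
    (hg : ∀ i, ContDiff ℝ 1
      (fun p : EuclideanSpace ℝ (Fin n) × EuclideanSpace ℝ (Fin m) => g p.1 p.2 i)) :
    Convex ℝ (SigmaSet f g xb yb) := by
  rintro lam ⟨h1, h2, h3, h4⟩ mu ⟨k1, k2, -, k4⟩ a b ha hb hab
  rw [gradyL_eq hf hg] at h1 k1
  refine ⟨?_, fun i => ?_, h3, ?_⟩
  · rw [gradyL_eq hf hg]
    have : grady f xb yb - ∑ i, (a • lam + b • mu) i • grady (fun x y => g x y i) xb yb =
        a • (grady f xb yb - ∑ i, lam i • grady (fun x y => g x y i) xb yb) +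
        b • (grady f xb yb - ∑ i, mu i • grady (fun x y => g x y i) xb yb) := by
      simp only [Pi.add_apply, Pi.smul_apply, smul_eq_mul, add_smul, mul_smul,
        Finset.sum_add_distrib, ← Finset.smul_sum, smul_sub]
      nth_rewrite 1 [← one_smul ℝ (grady f xb yb)]
      rw [← hab, add_smul]
      abel
    rw [this, h1, k1, smul_zero, smul_zero, add_zero]
  · exact add_nonneg (mul_nonneg ha (h2 i)) (mul_nonneg hb (k2 i))
  · have : ∑ i, (a • lam + b • mu) i * g xb yb i =
        a * ∑ i, lam i * g xb yb i + b * ∑ i, mu i * g xb yb i := by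
      simp only [Pi.add_apply, Pi.smul_apply, smul_eq_mul, add_mul, Finset.sum_add_distrib,
        Finset.mul_sum, mul_assoc]
    rw [this, h4, k4, mul_zero, mul_zero, add_zero]

theorem isClosed_SigmaSet
    (hf : ContDiff ℝ 1 (fun p : EuclideanSpace ℝ (Fin n) × EuclideanSpace ℝ (Fin m) => f p.1 p.2))
    (hg : ∀ i, ContDiff ℝ 1
      (fun p : EuclideanSpace ℝ (Fin n) × EuclideanSpace ℝ (Fin m) => g p.1 p.2 i)) :
    IsClosed (SigmaSet f g xb yb) := by
  simp only [SigmaSet, gradyL_eq hf hg, Set.ofPred_and, Set.ofPred_forall]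
  refine (isClosed_eq (by fun_prop) continuous_const).inter
    ((isClosed_iInter fun i => isClosed_le continuous_const (by fun_prop)).inter
      ((isClosed_iInter fun i => isClosed_const).inter
        (isClosed_eq (by fun_prop) continuous_const)))

theorem convex_image_gradxL
    (hf : ContDiff ℝ 1 (fun p : EuclideanSpace ℝ (Fin n) × EuclideanSpace ℝ (Fin m) => f p.1 p.2))
    (hg : ∀ i, ContDiff ℝ 1
      (fun p : EuclideanSpace ℝ (Fin n) × EuclideanSpace ℝ (Fin m) => g p.1 p.2 i))
    {s : Set (Fin q → ℝ)} (hs : Convex ℝ s) : Convex ℝ (gradxL f g xb yb '' s) := by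
  rintro _ ⟨lam, h1, rfl⟩ _ ⟨mu, k1, rfl⟩ a b ha hb hab
  refine ⟨a • lam + b • mu, hs h1 k1 ha hb hab, ?_⟩
  simp only [gradxL_eq hf hg, Pi.add_apply, Pi.smul_apply, smul_eq_mul, add_smul, mul_smul,
    Finset.sum_add_distrib, ← Finset.smul_sum, smul_sub]
  nth_rewrite 1 [← one_smul ℝ (gradx f xb yb)]
  rw [← hab, add_smul]
  abel

theorem LSub_subset_of_lipschitz
    (hf : ContDiff ℝ 1 (fun p : EuclideanSpace ℝ (Fin n) × EuclideanSpace ℝ (Fin m) => f p.1 p.2))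
    (hg : ∀ i, ContDiff ℝ 1
      (fun p : EuclideanSpace ℝ (Fin n) × EuclideanSpace ℝ (Fin m) => g p.1 p.2 i))
    (hyb : yb ∈ Feas g xb) (hisc : InnerSemicont f g xb yb) (heb : LocalErrorBound g xb yb)
    (hV : Vfun f g = fun x => (V x : EReal)) {K : NNReal} {r L : ℝ} (hr : 0 < r)
    (hLip : LipschitzOnWith K (fun x => -V x) (ball xb r))
    (hL : ∀ z ∈ ball xb r, ∀ u ∈ FSub (fun x => ((-V x : ℝ) : EReal)) z, ‖u‖ ≤ L) :
    LSub (fun x => (V x : EReal)) xb ⊆ gradxL f g xb yb '' SigmaSet f g xb yb := by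
  intro w hw
  obtain ⟨κ, hκ, hmult⟩ := exists_bounded_multiplier_of_mem_LSub hf hg hyb hisc heb hV
  obtain ⟨M, hM⟩ : ∃ M : ℝ, ∀ v : EuclideanSpace ℝ (Fin n), ‖v‖ ≤ L →
      ‖liftFunctional f 1 v (xb, yb)‖ ≤ M := by
    have hc : Continuous fun v => liftFunctional f 1 v (xb, yb) := by
      unfold liftFunctional
      fun_prop
    obtain ⟨M, hM⟩ := (isCompact_closedBall (0 : EuclideanSpace ℝ (Fin n))
      L).exists_bound_of_continuousOn hc.continuousOn
    exact ⟨M, fun v hv => hM v (mem_closedBall_zero_iff.2 hv)⟩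
  set T : Set (Fin q → ℝ) := SigmaSet f g xb yb ∩ Set.Icc 0 (fun _ => κ * M) with hT
  have hTconv : Convex ℝ T := (convex_SigmaSet hf hg).inter (convex_Icc _ _)
  have hTcomp : IsCompact T := isCompact_Icc.inter_left (isClosed_SigmaSet hf hg)
  have hgrad : Continuous (gradxL f g xb yb) := by
    rw [funext (gradxL_eq (x := xb) (y := yb) hf hg)]
    fun_prop
  suffices h : w ∈ gradxL f g xb yb '' T from Set.image_mono Set.inter_subset_left h
  by_contra hnot
  obtain ⟨Φ, c, hlt, hΦ⟩ := geometric_hahn_banach_point_closed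
    (convex_image_gradxL hf hg hTconv) (hTcomp.image hgrad).isClosed hnot
  set d := (InnerProductSpace.toDual ℝ _).symm Φ with hd
  have hΦd : ∀ v, Φ v = ⟪v, d⟫ := fun v => by
    rw [real_inner_comm, hd, InnerProductSpace.toDual_symm_apply]
  have hle : ⟪-w, d⟫ ≤ -c := by
    refine inner_neg_le_of_mem_LSub_neg hr hLip hL (fun u hu => ?_) (by simpa using hw)
    obtain ⟨lam, hlam, hbd, rfl⟩ := hmult u hu
    have hmem : lam ∈ T := ⟨hlam, hlam.2.1, fun i => (hbd i).trans
      (mul_le_mul_of_nonneg_left (hM _ (norm_le_of_mem_LSub hr hL hu)) hκ)⟩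
    rw [inner_neg_left, ← hΦd]
    exact neg_le_neg (hΦ _ ⟨lam, hmem, rfl⟩).le
  rw [inner_neg_left, ← hΦd] at hle
  linarith

end ValueFunction

/-- Theorem 3.1 — subdifferentials of the value function under inner
semicontinuity and a local error bound. -/
theorem stmt1 {n m q : ℕ}
    (f : EuclideanSpace ℝ (Fin n) → EuclideanSpace ℝ (Fin m) → ℝ)
    (g : EuclideanSpace ℝ (Fin n) → EuclideanSpace ℝ (Fin m) → Fin q → ℝ)
    (hf : ContDiff ℝ 1 (fun p : EuclideanSpace ℝ (Fin n) × EuclideanSpace ℝ (Fin m) => f p.1 p.2))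
    (hg : ∀ i, ContDiff ℝ 1
      (fun p : EuclideanSpace ℝ (Fin n) × EuclideanSpace ℝ (Fin m) => g p.1 p.2 i))
    (xb : EuclideanSpace ℝ (Fin n)) (yb : EuclideanSpace ℝ (Fin m))
    (hyb : yb ∈ Sol f g xb)
    (hisc : InnerSemicont f g xb yb)
    (heb : LocalErrorBound g xb yb) :
    (ContinuousAt (fun x => -(Vfun f g x)) xb ∧
      LSub (fun x => -(Vfun f g x)) xb ⊆
        {v | ∃ lam ∈ SigmaSet f g xb yb, v = -(gradxL f g xb yb lam)} ∧
      HorSub (fun x => -(Vfun f g x)) xb ⊆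
        {v | ∃ lam ∈ SigmaZero g xb yb,
          v = ∑ i, lam i • gradx (fun x y => g x y i) xb yb}) ∧
    ({v | ∃ lam ∈ SigmaZero g xb yb,
        v = ∑ i, lam i • gradx (fun x y => g x y i) xb yb} = {0} →
      LipschitzNearAt (Vfun f g) xb ∧
      LSub (Vfun f g) xb ⊆ CSub (Vfun f g) xb ∧
      CSub (Vfun f g) xb ⊆ {v | ∃ lam ∈ SigmaSet f g xb yb, v = gradxL f g xb yb lam}) := by
  obtain ⟨V, hV⟩ := hisc.exists_real_valueFunction
  have hneg : (fun x => -(Vfun f g x)) = fun x => ((-V x : ℝ) : EReal) := by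
    simp [hV, EReal.coe_neg]
  have hVc : ContinuousAt V xb := hisc.continuousAt hf hyb hV
  have hcont : ContinuousAt (fun x => ((-V x : ℝ) : EReal)) xb :=
    continuous_coe_real_ereal.continuousAt.comp hVc.neg
  have hHor := HorSub_neg_subset hf hg hyb.1 hisc heb hV
  rw [hneg, hV]
  refine ⟨⟨hcont, fun v hv => ?_, hHor⟩, fun hzero => ?_⟩
  · obtain ⟨κ, -, hmult⟩ := exists_bounded_multiplier_of_mem_LSub hf hg hyb.1 hisc heb hV
    obtain ⟨lam, hlam, -, h⟩ := hmult v hv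
    exact ⟨lam, hlam, h⟩
  · obtain ⟨L, r₁, hr₁, hL⟩ := exists_FSub_bound hcont (hHor.trans hzero.subset)
    obtain ⟨r₂, hr₂, hlsc⟩ := hisc.exists_lowerSemicontinuousOn_neg hf hg hV
    obtain ⟨δ, hδ, K, hLip⟩ := exists_lipschitzOnWith_of_FSub_bound (lt_min hr₁ hr₂) hVc.neg
      (hlsc.mono (ball_subset_ball (min_le_right _ _)))
      fun z hz => hL z (ball_subset_ball (min_le_left _ _) hz)
    have hLipV : LipschitzOnWith K V (ball xb δ) := by
      simpa only [neg_neg] using hLip.neg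
    obtain ⟨ψ, hψ, heq⟩ := hLipV.extend_real
    refine ⟨⟨δ, hδ, K, ψ, hψ, fun x hx => congrArg _ (heq hx)⟩, subset_convexHull ℝ _, ?_⟩
    have hsub := LSub_subset_of_lipschitz hf hg hyb.1 hisc heb hV (lt_min hr₁ hδ)
      (hLip.mono (ball_subset_ball (min_le_right _ _)))
      fun z hz => hL z (ball_subset_ball (min_le_left _ _) hz)
    refine (convexHull_min hsub (convex_image_gradxL hf hg (convex_SigmaSet hf hg))).trans ?_
    rintro _ ⟨lam, hlam, rfl⟩
    exact ⟨lam, hlam, rfl⟩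
end

section
/- Let ȳ ∈ S(x̄). Suppose the solution map S is inner semicontinuous at (x̄,ȳ) and MFCQ holds for the system g(x̄,y) ≤ 0 at ȳ. Then V is Lipschitz continuous near x̄ and ∂V(x̄) ⊆ {∇_x L(x̄,ȳ,λ) : λ ∈ Σ(x̄,ȳ)}. -/
open Filter Topology Metric RealInnerProductSpace

/-- Gordan's theorem of the alternative. -/
lemma exists_nonneg_sum_smul_eq_zero {ι E : Type*} [Fintype ι] [NormedAddCommGroup E]
    [NormedSpace ℝ E] (a : ι → E →L[ℝ] ℝ) (h : ∀ z, ∃ i, 0 ≤ a i z) :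
    ∃ l : ι → ℝ, (∀ i, 0 ≤ l i) ∧ l ≠ 0 ∧ ∀ z, ∑ i, l i * a i z = 0 := by
  classical
  let T : E →ₗ[ℝ] (ι → ℝ) := LinearMap.pi fun i => (a i).toLinearMap
  let s : Set (ι → ℝ) := Set.univ.pi fun _ => Set.Iio 0
  have hs : Convex ℝ s := convex_pi fun _ _ => convex_Iio 0
  have hso : IsOpen s := isOpen_set_pi Set.finite_univ fun _ _ => isOpen_Iio
  have hd : Disjoint s (LinearMap.range T : Set (ι → ℝ)) := by
    rw [Set.disjoint_left]
    rintro _ hv ⟨z, rfl⟩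
    obtain ⟨i, hi⟩ := h z
    exact absurd (hv i trivial) (not_lt.2 hi)
  obtain ⟨φ, u, hu, hv⟩ := geometric_hahn_banach_open hs hso (LinearMap.range T).convex hd
  have hu0 : u ≤ 0 := by simpa using hv 0 (Submodule.zero_mem _)
  have hT : ∀ z, φ (T z) = 0 := by
    intro z
    by_contra hne
    have h1 := hv (T (((u - 1) / φ (T z)) • z)) ⟨_, rfl⟩
    rw [map_smul, map_smul, smul_eq_mul, div_mul_cancel₀ _ hne] at h1
    linarith
  have hsum : ∀ w : ι → ℝ, φ w = ∑ i, φ (Pi.single i 1) * w i := by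
    intro w
    conv_lhs => rw [pi_eq_sum_univ' w]
    simp [map_sum, mul_comm, Pi.single]
  refine ⟨fun i => φ (Pi.single i 1), fun i => ?_, fun h0 => ?_, fun z => ?_⟩
  · have hw : ∀ t : ℝ, 0 < t → φ (-Pi.single i 1) - t * φ 1 < 0 := by
      intro t ht
      have h1 := hu (-Pi.single i 1 - t • 1) fun j _ => by
        by_cases hj : j = i
        · subst hj; simp; linarith
        · simp [Pi.single_eq_of_ne hj, ht]
      rw [map_sub, map_smul, smul_eq_mul] at h1
      linarith
    have hlim : Tendsto (fun t : ℝ => φ (-Pi.single i 1) - t * φ 1) (𝓝[>] 0)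
        (𝓝 (φ (-Pi.single i 1) - 0 * φ 1)) :=
      ((continuous_const.sub (continuous_id.mul continuous_const)).tendsto 0).mono_left
        nhdsWithin_le_nhds
    have h2 := le_of_tendsto hlim
      (eventually_nhdsWithin_of_forall fun t ht => (hw t ht).le)
    rw [map_neg] at h2
    linarith
  · have h1 := hu (-1) fun j _ => by simp
    rw [hsum] at h1
    have h2 : ∀ i, φ (Pi.single i 1) = 0 := fun i => congrFun h0 i
    simp [h2] at h1
    linarith
  · rw [← hT z, hsum]
    rfl

/-- Gordan's theorem of the alternative for the subfamily selected by `P`. -/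
lemma exists_nonneg_sum_smul_eq_zero_of_subfamily {ι E : Type*} [Fintype ι]
    [NormedAddCommGroup E] [NormedSpace ℝ E] (a : ι → E →L[ℝ] ℝ) (P : ι → Prop)
    (h : ∀ z, ∃ i, P i ∧ 0 ≤ a i z) :
    ∃ l : ι → ℝ, (∀ i, 0 ≤ l i) ∧ l ≠ 0 ∧ (∀ i, ¬ P i → l i = 0) ∧
      ∀ z, ∑ i, l i * a i z = 0 := by
  classical
  obtain ⟨l, hl0, hlne, hl⟩ := exists_nonneg_sum_smul_eq_zero (fun i : {i // P i} => a i)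
    fun z => by
      obtain ⟨i, hi, hz⟩ := h z
      exact ⟨⟨i, hi⟩, hz⟩
  refine ⟨fun i => if hi : P i then l ⟨i, hi⟩ else 0, fun i => ?_, fun h0 => ?_,
    fun i hi => dif_neg hi, fun z => ?_⟩
  · by_cases hi : P i <;> simp [hi, hl0]
  · exact hlne (funext fun i => by simpa [i.2] using congrFun h0 i)
  · rw [← Finset.sum_filter_of_ne (p := P) (s := Finset.univ), Finset.sum_subtype _ (p := P) (by simp)]
    · exact (Finset.sum_congr rfl fun i _ => by simp [i.2]).trans (hl z)
    · intro i _ hne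
      by_contra hi
      exact hne (by simp [hi])

/-- Farkas' lemma under a Slater-type condition, for the subfamily selected by `P`. -/
lemma exists_nonneg_eq_sum_smul_of_subfamily {ι E : Type*} [Fintype ι]
    [NormedAddCommGroup E] [NormedSpace ℝ E] (a : ι → E →L[ℝ] ℝ) (P : ι → Prop)
    (b : E →L[ℝ] ℝ) {d : E} (hd : ∀ i, P i → a i d < 0)
    (h : ∀ z, (∀ i, P i → a i z < 0) → b z ≤ 0) :
    ∃ l : ι → ℝ, (∀ i, 0 ≤ l i) ∧ (∀ i, ¬ P i → l i = 0) ∧ ∀ z, b z = ∑ i, l i * a i z := by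
  obtain ⟨l, hl0, hlne, hlP, hl⟩ := exists_nonneg_sum_smul_eq_zero_of_subfamily
    (fun o : Option ι => o.elim (-b) a) (fun o => o.elim True P) fun z => by
      by_cases hz : ∀ i, P i → a i z < 0
      · exact ⟨none, trivial, by simpa using h z hz⟩
      · push Not at hz
        obtain ⟨i, hi, hz⟩ := hz
        exact ⟨some i, hi, hz⟩
  simp only [Fintype.sum_option, Option.elim_none, Option.elim_some,
    neg_apply] at hl
  have hterm : ∀ i, l (some i) * a i d ≤ 0 := by
    intro i
    by_cases hi : P i
    · exact mul_nonpos_of_nonneg_of_nonpos (hl0 _) (hd i hi).le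
    · simp [hlP (some i) hi]
  have hpos : 0 < l none := by
    refine (hl0 none).lt_of_ne' fun h0 => hlne (funext fun o => ?_)
    have hz := hl d
    rw [h0, zero_mul, zero_add, Finset.sum_eq_zero_iff_of_nonpos fun i _ => hterm i] at hz
    cases o with
    | none => exact h0
    | some i =>
      by_cases hi : P i
      · exact (mul_eq_zero.1 (hz i (Finset.mem_univ i))).resolve_right (hd i hi).ne
      · exact hlP (some i) hi
  refine ⟨fun i => l (some i) / l none, fun i => div_nonneg (hl0 _) hpos.le,
    fun i hi => by simp [hlP (some i) hi], fun z => ?_⟩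
  have hz := hl z
  simp only [div_mul_eq_mul_div, ← Finset.sum_div]
  rw [eq_div_iff hpos.ne']
  linarith

lemma HasStrictFDerivAt.eventually_abs_sub_le {W : Type*} [NormedAddCommGroup W]
    [NormedSpace ℝ W] {F : W → ℝ} {F' : W →L[ℝ] ℝ} {p₀ : W} (hF : HasStrictFDerivAt F F' p₀)
    {C ε : ℝ} (hC : 0 < C) (hε : 0 < ε) :
    ∀ᶠ p : W × W in 𝓝 (p₀, p₀), ∀ r, ‖p.1 - p.2‖ ≤ C * r →
      |F p.1 - F p.2 - F' (p.1 - p.2)| ≤ ε * r := by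
  filter_upwards [hF.isLittleO.def (div_pos hε hC)] with p hp r hr
  rw [Real.norm_eq_abs] at hp
  calc _ ≤ ε / C * ‖p.1 - p.2‖ := hp
    _ ≤ ε / C * (C * r) := by gcongr
    _ = ε * r := by field_simp

/-- Moving from a feasible point near `p₀` along a direction that strictly decreases the
linearizations of the active constraints preserves feasibility. -/
lemma eventually_nonpos_of_active_descent {W ι : Type*} [Finite ι] [NormedAddCommGroup W]
    [NormedSpace ℝ W] {G : W → ι → ℝ} {G' : ι → W →L[ℝ] ℝ} {p₀ : W}
    (hG : ∀ i, HasStrictFDerivAt (fun p => G p i) (G' i) p₀) (hp₀ : ∀ i, G p₀ i ≤ 0)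
    {C η : ℝ} (hC : 0 < C) (hη : 0 < η) :
    ∀ᶠ p : W × W in 𝓝 (p₀, p₀), ∀ r, ‖p.1 - p.2‖ ≤ C * r →
      (∀ i, G p₀ i = 0 → G' i (p.1 - p.2) ≤ -(η * r)) →
      (∀ i, G p.2 i ≤ 0) → ∀ i, G p.1 i ≤ 0 := by
  have key : ∀ i, ∀ᶠ p : W × W in 𝓝 (p₀, p₀), ∀ r, ‖p.1 - p.2‖ ≤ C * r →
      (G p₀ i = 0 → G' i (p.1 - p.2) ≤ -(η * r)) → G p.2 i ≤ 0 → G p.1 i ≤ 0 := by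
    intro i
    rcases (hp₀ i).lt_or_eq with hlt | heq
    · have hc : Tendsto (fun p : W × W => G p.1 i) (𝓝 (p₀, p₀)) (𝓝 (G p₀ i)) :=
        (hG i).continuousAt.tendsto.comp continuous_fst.continuousAt
      filter_upwards [hc.eventually_lt_const hlt] with p hp r _ _ _ using hp.le
    · filter_upwards [(hG i).eventually_abs_sub_le hC hη] with p hp r hr hd h2
      have h3 := (abs_le.1 (hp r hr)).2
      linarith [hd heq]
  filter_upwards [eventually_all.2 key] with p hp r hr hd h2 i using hp i r hr (hd i) (h2 i)

section ValueFunction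

variable {n m q : ℕ} {f : EuclideanSpace ℝ (Fin n) → EuclideanSpace ℝ (Fin m) → ℝ}
  {g : EuclideanSpace ℝ (Fin n) → EuclideanSpace ℝ (Fin m) → Fin q → ℝ}
  {xb : EuclideanSpace ℝ (Fin n)} {yb : EuclideanSpace ℝ (Fin m)}

lemma coe_le_Vfun {x : EuclideanSpace ℝ (Fin n)} {y : EuclideanSpace ℝ (Fin m)}
    (hy : y ∈ Feas g x) : (f x y : EReal) ≤ Vfun f g x :=
  le_sSup ⟨y, hy, rfl⟩

lemma InnerSemicont.eventually_exists (h : InnerSemicont f g xb yb)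
    {U : Set (EuclideanSpace ℝ (Fin m))} (hU : U ∈ 𝓝 yb) :
    ∀ᶠ x in 𝓝 xb, ∃ y ∈ Sol f g x, y ∈ U := by
  by_contra hcon
  obtain ⟨xk, hxk, hk⟩ := exists_seq_forall_of_frequently (not_eventually.1 hcon)
  obtain ⟨yk, hyk, hlim⟩ := h xk hxk
  obtain ⟨k, hkU⟩ := (hlim.eventually_mem hU).exists
  exact hk k ⟨yk k, hyk k, hkU⟩

lemma InnerSemicont.exists_real (h : InnerSemicont f g xb yb) :
    ∃ V : EuclideanSpace ℝ (Fin n) → ℝ, ∀ᶠ x in 𝓝 xb, Vfun f g x = V x := by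
  refine ⟨fun x => (Vfun f g x).toReal, ?_⟩
  filter_upwards [h.eventually_exists univ_mem] with x ⟨y, hy, _⟩
  rw [← hy.2, EReal.toReal_coe]

variable {f' : EuclideanSpace ℝ (Fin n) × EuclideanSpace ℝ (Fin m) →L[ℝ] ℝ}
  {g' : Fin q → EuclideanSpace ℝ (Fin n) × EuclideanSpace ℝ (Fin m) →L[ℝ] ℝ}

/-- One-sided estimate of the increments of the value function along a direction that strictly
decreases the linearized active constraints. -/
lemma InnerSemicont.eventually_Vfun_ge (h : InnerSemicont f g xb yb)
    (hf' : HasStrictFDerivAt (fun p => f p.1 p.2) f' (xb, yb))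
    (hg' : ∀ i, HasStrictFDerivAt (fun p => g p.1 p.2 i) (g' i) (xb, yb))
    (hyb : yb ∈ Feas g xb) {V : EuclideanSpace ℝ (Fin n) → ℝ}
    (hV : ∀ᶠ x in 𝓝 xb, Vfun f g x = V x) (w : EuclideanSpace ℝ (Fin m))
    {C η ε : ℝ} (hC : 0 < C) (hη : 0 < η) (hε : 0 < ε) :
    ∀ᶠ p : (EuclideanSpace ℝ (Fin n) × EuclideanSpace ℝ (Fin n)) × ℝ in 𝓝 ((xb, xb), 0),
      ‖(p.1.1 - p.1.2, p.2 • w)‖ ≤ C * p.2 →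
      (∀ i, g xb yb i = 0 → g' i (p.1.1 - p.1.2, p.2 • w) ≤ -(η * p.2)) →
      V p.1.2 + f' (p.1.1 - p.1.2, p.2 • w) - ε * p.2 ≤ V p.1.1 := by
  have hev := (hf'.eventually_abs_sub_le hC hε).and
    (eventually_nonpos_of_active_descent (p₀ := (xb, yb))
      (G := fun (p : EuclideanSpace ℝ (Fin n) × EuclideanSpace ℝ (Fin m)) i => g p.1 p.2 i) hg' hyb hC hη)
  have hmap : Tendsto (fun s : ((EuclideanSpace ℝ (Fin n) × EuclideanSpace ℝ (Fin n)) × ℝ) ×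
      EuclideanSpace ℝ (Fin m) => ((s.1.1.1, s.2 + s.1.2 • w), (s.1.1.2, s.2)))
      (𝓝 (((xb, xb), 0), yb)) (𝓝 ((xb, yb), (xb, yb))) := by
    have hc : Continuous (fun s : ((EuclideanSpace ℝ (Fin n) × EuclideanSpace ℝ (Fin n)) × ℝ) ×
      EuclideanSpace ℝ (Fin m) => ((s.1.1.1, s.2 + s.1.2 • w), (s.1.1.2, s.2))) := by fun_prop
    simpa using hc.tendsto (((xb, xb), 0), yb)
  have hev2 := hmap.eventually hev
  rw [nhds_prod_eq] at hev2
  obtain ⟨P, hP, Q, hQ, hPQ⟩ := eventually_prod_iff.1 hev2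
  have h1 : Tendsto (fun p : (EuclideanSpace ℝ (Fin n) × EuclideanSpace ℝ (Fin n)) × ℝ => p.1.1)
      (𝓝 ((xb, xb), 0)) (𝓝 xb) :=
    (continuous_fst.comp continuous_fst).tendsto ((xb, xb), (0 : ℝ))
  have h2 : Tendsto (fun p : (EuclideanSpace ℝ (Fin n) × EuclideanSpace ℝ (Fin n)) × ℝ => p.1.2)
      (𝓝 ((xb, xb), 0)) (𝓝 xb) :=
    (continuous_snd.comp continuous_fst).tendsto ((xb, xb), (0 : ℝ))
  filter_upwards [hP, h1.eventually hV, h2.eventually hV,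
    h2.eventually (h.eventually_exists hQ)] with p hp hV1 hV2 ⟨y, hy, hyQ⟩ hC1 hd
  obtain ⟨hfe, hge⟩ := hPQ hp hyQ
  have hsub : ((p.1.1, y + p.2 • w) : EuclideanSpace ℝ (Fin n) × EuclideanSpace ℝ (Fin m))
      - (p.1.2, y) = (p.1.1 - p.1.2, p.2 • w) := by simp
  simp only [hsub] at hfe hge
  have hfeas : y + p.2 • w ∈ Feas g p.1.1 := hge p.2 hC1 hd hy.1
  have hle := coe_le_Vfun (f := f) hfeas
  have heq := hy.2
  rw [hV1, EReal.coe_le_coe_iff] at hle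
  rw [hV2, EReal.coe_eq_coe_iff] at heq
  linarith [(abs_le.1 (hfe p.2 hC1)).1]

lemma inner_grady_of_hasFDerivAt {φ : EuclideanSpace ℝ (Fin n) → EuclideanSpace ℝ (Fin m) → ℝ}
    {φ' : EuclideanSpace ℝ (Fin n) × EuclideanSpace ℝ (Fin m) →L[ℝ] ℝ}
    (h : HasFDerivAt (fun p => φ p.1 p.2) φ' (xb, yb)) (w : EuclideanSpace ℝ (Fin m)) :
    ⟪grady φ xb yb, w⟫ = φ' (0, w) := by
  have h1 : HasFDerivAt (fun y => φ xb y)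
      (φ'.comp (ContinuousLinearMap.inr ℝ _ _)) yb :=
    HasFDerivAt.comp (g := fun p : EuclideanSpace ℝ (Fin n) × EuclideanSpace ℝ (Fin m) =>
      φ p.1 p.2)
      (f := fun y => (xb, y)) yb h (hasFDerivAt_prodMk_right xb yb)
  rw [grady, inner_gradient_left, h1.fderiv]
  simp

lemma inner_gradx_of_hasFDerivAt {φ : EuclideanSpace ℝ (Fin n) → EuclideanSpace ℝ (Fin m) → ℝ}
    {φ' : EuclideanSpace ℝ (Fin n) × EuclideanSpace ℝ (Fin m) →L[ℝ] ℝ}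
    (h : HasFDerivAt (fun p => φ p.1 p.2) φ' (xb, yb)) (u : EuclideanSpace ℝ (Fin n)) :
    ⟪gradx φ xb yb, u⟫ = φ' (u, 0) := by
  have h1 : HasFDerivAt (fun x => φ x yb)
      (φ'.comp (ContinuousLinearMap.inl ℝ _ _)) xb :=
    HasFDerivAt.comp (g := fun p : EuclideanSpace ℝ (Fin n) × EuclideanSpace ℝ (Fin m) =>
      φ p.1 p.2)
      (f := fun x => (x, yb)) xb h (hasFDerivAt_prodMk_left xb yb)
  rw [gradx, inner_gradient_left, h1.fderiv]
  simp

/-- The Mangasarian-Fromovitz direction obtained from the dual form of the qualification. -/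
lemma MFCQy.exists_descent (h : MFCQy g xb yb)
    (hg' : ∀ i, HasFDerivAt (fun p => g p.1 p.2 i) (g' i) (xb, yb))
    (hyb : yb ∈ Feas g xb) :
    ∃ d, ∀ i, g xb yb i = 0 → g' i (0, d) < 0 := by
  by_contra! hcon
  obtain ⟨l, hl0, hlne, hlP, hl⟩ := exists_nonneg_sum_smul_eq_zero_of_subfamily
    (fun i => (g' i).comp (ContinuousLinearMap.inr ℝ
      (EuclideanSpace ℝ (Fin n)) (EuclideanSpace ℝ (Fin m)))) (fun i => g xb yb i = 0)
    (fun z => by simpa using hcon z)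
  refine hlne (h l hl0 (Finset.sum_eq_zero fun i _ => ?_) hyb ?_)
  · by_cases hi : g xb yb i = 0
    · simp [hi]
    · simp [hlP i hi]
  · refine ext_inner_right ℝ fun w => ?_
    simpa [sum_inner, inner_smul_left,
      fun i => inner_grady_of_hasFDerivAt (φ := fun x y => g x y i) (hg' i) w] using hl w

/-- Lipschitz continuity of the value function near the reference point. -/
lemma InnerSemicont.lipschitzNearAt (h : InnerSemicont f g xb yb)
    (hf' : HasStrictFDerivAt (fun p => f p.1 p.2) f' (xb, yb))
    (hg' : ∀ i, HasStrictFDerivAt (fun p => g p.1 p.2 i) (g' i) (xb, yb))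
    (hyb : yb ∈ Feas g xb) {d : EuclideanSpace ℝ (Fin m)}
    (hd : ∀ i, g xb yb i = 0 → g' i (0, d) < 0) :
    LipschitzNearAt (Vfun f g) xb := by
  obtain ⟨V, hV⟩ := h.exists_real
  obtain ⟨c, hc, hcd⟩ : ∃ c > 0, ∀ i, g xb yb i = 0 → ‖g' i‖ + 1 ≤ c * -g' i (0, d) := by
    have hex : ∀ i, ∀ᶠ c : ℝ in atTop, g xb yb i = 0 → ‖g' i‖ + 1 ≤ c * -g' i (0, d) := by
      intro i
      by_cases hi : g xb yb i = 0
      · filter_upwards [(tendsto_id.atTop_mul_const (neg_pos.2 (hd i hi))).eventually_ge_atTop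
          (‖g' i‖ + 1)] with c hc _ using hc
      · exact Eventually.of_forall fun c h => absurd h hi
    obtain ⟨c, hc, hc'⟩ := ((eventually_gt_atTop 0).and (eventually_all.2 hex)).exists
    exact ⟨c, hc, hc'⟩
  have hC : 0 < 1 + ‖c • d‖ := by positivity
  have hev := h.eventually_Vfun_ge hf' hg' hyb hV (c • d) hC one_pos one_pos
  have hmap : Tendsto (fun p : EuclideanSpace ℝ (Fin n) × EuclideanSpace ℝ (Fin n) =>
      (p, ‖p.1 - p.2‖)) (𝓝 (xb, xb)) (𝓝 ((xb, xb), 0)) := by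
    have hcont : Continuous (fun p : EuclideanSpace ℝ (Fin n) × EuclideanSpace ℝ (Fin n) =>
      (p, ‖p.1 - p.2‖)) := by fun_prop
    simpa using hcont.tendsto (xb, xb)
  have hev2 := hmap.eventually hev
  obtain ⟨δ₁, hδ₁, hball₁⟩ := Metric.eventually_nhds_iff_ball.1 hev2
  obtain ⟨δ₂, hδ₂, hball₂⟩ := Metric.eventually_nhds_iff_ball.1 hV
  let K : ℝ := ‖f'‖ * (1 + ‖c • d‖) + 1
  have hlip : LipschitzOnWith (Real.toNNReal K) V (ball xb (min δ₁ δ₂)) := by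
    refine LipschitzOnWith.of_le_add_mul' K fun x hx x' hx' => ?_
    have hx1 := ball_subset_ball (min_le_left _ _) hx
    have hx1' := ball_subset_ball (min_le_left _ _) hx'
    have hn : ‖(x' - x, ‖x' - x‖ • c • d)‖ ≤ (1 + ‖c • d‖) * ‖x' - x‖ := by
      rw [Prod.norm_mk, norm_smul, norm_norm]
      refine max_le ?_ ?_ <;> nlinarith [norm_nonneg (x' - x), norm_nonneg (c • d)]
    have hb := hball₁ (x', x) (by rw [← ball_prod_same]; exact ⟨hx1', hx1⟩) hn fun i hi => by
      have hsplit : ((x' - x, ‖x' - x‖ • c • d) :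
          EuclideanSpace ℝ (Fin n) × EuclideanSpace ℝ (Fin m)) =
          (x' - x, 0) + (‖x' - x‖ * c) • (0, d) := by simp [mul_smul]
      have h1 : g' i (x' - x, 0) ≤ ‖g' i‖ * ‖x' - x‖ := by
        simpa using (le_abs_self _).trans ((g' i).le_opNorm (x' - x, 0))
      dsimp only
      rw [hsplit, map_add, map_smul, smul_eq_mul]
      nlinarith [hcd i hi, norm_nonneg (x' - x)]
    have h2 : |f' (x' - x, ‖x' - x‖ • c • d)| ≤ ‖f'‖ * ((1 + ‖c • d‖) * ‖x' - x‖) :=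
      (f'.le_opNorm _).trans (by gcongr)
    rw [dist_comm, dist_eq_norm]
    dsimp only at hb
    have h3 := (abs_le.1 h2).1
    simp only [K]
    linarith
  obtain ⟨ψ, hψ, heq⟩ := hlip.extend_real
  refine ⟨min δ₁ δ₂, lt_min hδ₁ hδ₂, _, ψ, hψ, fun x hx => ?_⟩
  rw [hball₂ x (ball_subset_ball (min_le_right _ _) hx), heq hx]

/-- Limiting subgradients of the value function are dominated along every direction strictly
decreasing the linearized active constraints. -/
lemma InnerSemicont.fderiv_sub_inner_nonpos (h : InnerSemicont f g xb yb)
    (hf' : HasStrictFDerivAt (fun p => f p.1 p.2) f' (xb, yb))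
    (hg' : ∀ i, HasStrictFDerivAt (fun p => g p.1 p.2 i) (g' i) (xb, yb))
    (hyb : yb ∈ Feas g xb) {v : EuclideanSpace ℝ (Fin n)} (hv : v ∈ LSub (Vfun f g) xb)
    {u : EuclideanSpace ℝ (Fin n)} {w : EuclideanSpace ℝ (Fin m)}
    (hz : ∀ i, g xb yb i = 0 → g' i (u, w) < 0) :
    f' (u, w) - ⟪v, u⟫ ≤ 0 := by
  obtain ⟨V, hV⟩ := h.exists_real
  obtain ⟨xk, vk, hvk, hxk, -, hvlim⟩ := hv
  obtain ⟨η, hη, hη'⟩ : ∃ η > 0, ∀ i, g xb yb i = 0 → g' i (u, w) ≤ -η := by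
    have hex : ∀ i, ∀ᶠ η : ℝ in 𝓝[>] 0, g xb yb i = 0 → g' i (u, w) ≤ -η := by
      intro i
      by_cases hi : g xb yb i = 0
      · filter_upwards [nhdsWithin_le_nhds (eventually_le_nhds (neg_pos.2 (hz i hi)))]
          with η hη _
        linarith
      · exact Eventually.of_forall fun c h => absurd h hi
    obtain ⟨c, hc, hc'⟩ := ((eventually_mem_nhdsWithin (a := (0 : ℝ)) (s := Set.Ioi 0)).and
      (eventually_all.2 hex)).exists
    exact ⟨c, hc, hc'⟩
  have hC : 0 < 1 + ‖(u, w)‖ := by positivity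
  have key : ∀ ε > 0, f' (u, w) - ⟪v, u⟫ ≤ ε * (‖u‖ + 1) := by
    intro ε hε
    have hmap : Tendsto (fun p : EuclideanSpace ℝ (Fin n) × ℝ =>
        ((p.1, p.1 - p.2 • u), p.2)) (𝓝 (xb, 0)) (𝓝 ((xb, xb), 0)) := by
      have hcont : Continuous (fun p : EuclideanSpace ℝ (Fin n) × ℝ =>
        ((p.1, p.1 - p.2 • u), p.2)) := by fun_prop
      simpa using hcont.tendsto (xb, 0)
    have hev := (hmap.eventually (h.eventually_Vfun_ge hf' hg' hyb hV w hC hη hε)).curry_nhds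
    have hk : ∀ᶠ k in atTop, f' (u, w) - ⟪vk k, u⟫ ≤ ε * (‖u‖ + 1) := by
      filter_upwards [hxk.eventually hev, hxk.eventually hV.eventually_nhds] with k hk hVk
      obtain ⟨c, hc, hsub⟩ := hvk k
      obtain ⟨δ, hδ, hδsub⟩ := hsub ε hε
      have hline : Tendsto (fun t : ℝ => xk k - t • u) (𝓝[>] 0) (𝓝 (xk k)) := by
        have hcont : Continuous (fun t : ℝ => xk k - t • u) := by fun_prop
        simpa using (hcont.tendsto 0).mono_left nhdsWithin_le_nhds
      obtain ⟨t, ht, hkt, hVt, hball⟩ := ((eventually_mem_nhdsWithin (a := (0 : ℝ))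
        (s := Set.Ioi 0)).and ((hk.filter_mono nhdsWithin_le_nhds).and ((hline.eventually hVk).and
          (hline.eventually (ball_mem_nhds _ hδ))))).exists
      have ht : 0 < t := ht
      rw [hVk.self_of_nhds, EReal.coe_eq_coe_iff] at hc
      have h1 := hδsub _ (mem_ball_iff_norm.1 hball)
      rw [hVt, EReal.coe_le_coe_iff] at h1
      have hz' : (xk k - (xk k - t • u), t • w) = t • (u, w) := by simp
      have hnorm : xk k - t • u - xk k = -(t • u) := by abel
      simp only [hz', map_smul, smul_eq_mul, norm_smul, Real.norm_of_nonneg ht.le] at hkt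
      rw [hnorm, inner_neg_right, inner_smul_right, norm_neg, norm_smul,
        Real.norm_of_nonneg ht.le] at h1
      have h2 := hkt (by nlinarith) fun i hi => by nlinarith [hη' i hi]
      have h3 : t * (f' (u, w) - ⟪vk k, u⟫) ≤ t * (ε * (‖u‖ + 1)) := by linarith
      exact le_of_mul_le_mul_left h3 ht
    exact le_of_tendsto (tendsto_const_nhds.sub (hvlim.inner tendsto_const_nhds)) hk
  have hlim : Tendsto (fun ε : ℝ => ε * (‖u‖ + 1)) (𝓝[>] 0) (𝓝 (0 * (‖u‖ + 1))) :=
    ((continuous_id.mul continuous_const).tendsto 0).mono_left nhdsWithin_le_nhds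
  rw [zero_mul] at hlim
  exact ge_of_tendsto hlim (eventually_nhdsWithin_of_forall key)

end ValueFunction

/-- Corollary 3.1 — inner semicontinuity and MFCQ imply Lipschitz continuity of
the value function together with an upper estimate of its limiting subdifferential. -/
theorem stmt2 {n m q : ℕ}
    (f : EuclideanSpace ℝ (Fin n) → EuclideanSpace ℝ (Fin m) → ℝ)
    (g : EuclideanSpace ℝ (Fin n) → EuclideanSpace ℝ (Fin m) → Fin q → ℝ)
    (hf : ContDiff ℝ 1 (fun p : EuclideanSpace ℝ (Fin n) × EuclideanSpace ℝ (Fin m) => f p.1 p.2))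
    (hg : ∀ i, ContDiff ℝ 1
      (fun p : EuclideanSpace ℝ (Fin n) × EuclideanSpace ℝ (Fin m) => g p.1 p.2 i))
    (xb : EuclideanSpace ℝ (Fin n)) (yb : EuclideanSpace ℝ (Fin m))
    (hyb : yb ∈ Sol f g xb)
    (hisc : InnerSemicont f g xb yb)
    (hmfcq : MFCQy g xb yb) :
    LipschitzNearAt (Vfun f g) xb ∧
    LSub (Vfun f g) xb ⊆ {v | ∃ lam ∈ SigmaSet f g xb yb, v = gradxL f g xb yb lam} := by
  have hf' := hf.hasStrictFDerivAt one_ne_zero (x := (xb, yb))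
  have hg' := fun i => (hg i).hasStrictFDerivAt one_ne_zero (x := (xb, yb))
  have hfeas : yb ∈ Feas g xb := hyb.1
  obtain ⟨d, hd⟩ := hmfcq.exists_descent (fun i => (hg' i).hasFDerivAt) hfeas
  refine ⟨hisc.lipschitzNearAt hf' hg' hfeas hd, fun v hv => ?_⟩
  obtain ⟨l, hl0, hlP, hl⟩ := exists_nonneg_eq_sum_smul_of_subfamily _
    (fun i => g xb yb i = 0)
    (fderiv ℝ (fun p : EuclideanSpace ℝ (Fin n) × EuclideanSpace ℝ (Fin m) => f p.1 p.2) (xb, yb) -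
      (innerSL ℝ v).comp (ContinuousLinearMap.fst ℝ _ _)) hd
    fun z hz => by simpa using hisc.fderiv_sub_inner_nonpos hf' hg' hfeas hv (u := z.1) (w := z.2) hz
  have hL : HasFDerivAt
      (fun p : EuclideanSpace ℝ (Fin n) × EuclideanSpace ℝ (Fin m) => Lag f g p.1 p.2 l) _
      (xb, yb) :=
    hf'.hasFDerivAt.sub (HasFDerivAt.fun_sum fun i (_ : i ∈ Finset.univ) =>
      (hg' i).hasFDerivAt.const_mul (l i))
  refine ⟨l, ⟨?_, hl0, hfeas, Finset.sum_eq_zero fun i _ => ?_⟩, ?_⟩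
  · refine ext_inner_right ℝ fun w => ?_
    rw [gradyL, inner_grady_of_hasFDerivAt (φ := fun x y => Lag f g x y l) hL]
    have := hl (0, w)
    simp at this
    simp [this]
  · by_cases hi : g xb yb i = 0
    · simp [hi]
    · simp [hlP i hi]
  · refine ext_inner_right ℝ fun u => ?_
    rw [gradxL, inner_gradx_of_hasFDerivAt (φ := fun x y => Lag f g x y l) hL]
    have := hl (u, 0)
    simp at this
    simp [← this]
end
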